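/- arXiv:1904.06176 — 2 statements merged into one kernel-verified Lean document; each statement's English description precedes it below -/
import Mathlib

section
/- (L¹ Klainerman–Sobolev inequality.) For every n ≥ 1 there exists a constant C(n) such that for every t ≥ 0, every smooth compactly supported function ψ : ℝⁿ → ℝ, and every x ∈ ℝⁿ: |ψ(x)| ≤ C(n) (1 + t + |x|)^{−n} Σ_{|α| ≤ n, Z^α ∈ Γ^{|α|}} ‖Z^α ψ‖_{L¹(ℝⁿ_x)}. -/
noncomputable section

open MeasureTheory Real

/-- `E n` is the Euclidean space `ℝⁿ`. -/
abbrev E (n : ℕ) : Type := EuclideanSpace ℝ (Fin n)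

/-- Index set for the commuting vector fields: spatial translations `∂_{xⁱ}`,
uniform motions `t∂_{xⁱ} + ∂_{vⁱ}` (macroscopically `t∂_{xⁱ}`),
rotations `Ωˣᵢⱼ + Ωᵛᵢⱼ` for `i < j` (macroscopically `Ωˣᵢⱼ`),
and the scaling `Sˣ + Sᵛ` (macroscopically `Sˣ`). -/
abbrev VFIdx (n : ℕ) : Type := Fin n ⊕ Fin n ⊕ {p : Fin n × Fin n // p.1 < p.2} ⊕ Unit

variable {n : ℕ}

/-- Partial derivative of `g : ℝⁿ → ℝ` at `x` in the `i`-th coordinate direction. -/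
def pd (i : Fin n) (g : E n → ℝ) (x : E n) : ℝ :=
  fderiv ℝ g x (EuclideanSpace.single i 1)

/-- Iterated coordinate partial derivatives `∂ₓ^α`. -/
def pdList (ds : List (Fin n)) (g : E n → ℝ) : E n → ℝ :=
  ds.foldr (fun i h => pd i h) g

/-- The action of a microscopic vector field of the family `γ`
on a function `f(t,x,v)`. -/
def microApply (Z : VFIdx n) (f : ℝ → E n → E n → ℝ) : ℝ → E n → E n → ℝ :=
  fun t x v =>
    match Z with
    | Sum.inl i => pd i (fun y => f t y v) x
    | Sum.inr (Sum.inl i) => t * pd i (fun y => f t y v) x + pd i (fun w => f t x w) v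
    | Sum.inr (Sum.inr (Sum.inl p)) =>
        x p.1.1 * pd p.1.2 (fun y => f t y v) x - x p.1.2 * pd p.1.1 (fun y => f t y v) x
          + v p.1.1 * pd p.1.2 (fun w => f t x w) v - v p.1.2 * pd p.1.1 (fun w => f t x w) v
    | Sum.inr (Sum.inr (Sum.inr _)) =>
        (∑ i, x i * pd i (fun y => f t y v) x) + ∑ i, v i * pd i (fun w => f t x w) v

/-- The action of a macroscopic vector field of the family `Γ`
on a function `φ(t,x)`. -/
def macroApply (Z : VFIdx n) (φ : ℝ → E n → ℝ) : ℝ → E n → ℝ :=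
  fun t x =>
    match Z with
    | Sum.inl i => pd i (φ t) x
    | Sum.inr (Sum.inl i) => t * pd i (φ t) x
    | Sum.inr (Sum.inr (Sum.inl p)) =>
        x p.1.1 * pd p.1.2 (φ t) x - x p.1.2 * pd p.1.1 (φ t) x
    | Sum.inr (Sum.inr (Sum.inr _)) => ∑ i, x i * pd i (φ t) x

/-- Composition `Z^α = Z^{α₁} ⋯ Z^{α_k}` of microscopic vector fields. -/
def microList (L : List (VFIdx n)) (f : ℝ → E n → E n → ℝ) : ℝ → E n → E n → ℝ :=
  L.foldr microApply f

/-- Composition `Z^α = Z^{α₁} ⋯ Z^{α_k}` of macroscopic vector fields. -/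
def macroList (L : List (VFIdx n)) (φ : ℝ → E n → ℝ) : ℝ → E n → ℝ :=
  L.foldr macroApply φ

/-- Velocity average `ρ(f)(t,x) = ∫ f(t,x,v) dv`. -/
def rho (f : ℝ → E n → E n → ℝ) (t : ℝ) (x : E n) : ℝ := ∫ v : E n, f t x v

/-- The spatial Laplacian. -/
def lap (g : E n → ℝ) (x : E n) : ℝ := ∑ i, pd i (fun y => pd i g y) x

/-- The free transport operator `T(f) = ∂_t f + v·∇ₓ f`. -/
def Tfree (f : ℝ → E n → E n → ℝ) : ℝ → E n → E n → ℝ :=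
  fun t x v => deriv (fun s => f s x v) t + ∑ i, v i * pd i (fun y => f t y v) x

/-- The perturbed transport operator `T_φ(f) = ∂_t f + v·∇ₓ f + μ ∇ₓφ·∇ᵥ f`. -/
def Tphi (μ : ℝ) (φ : ℝ → E n → ℝ) (f : ℝ → E n → E n → ℝ) : ℝ → E n → E n → ℝ :=
  fun t x v => Tfree f t x v + μ * ∑ i, pd i (φ t) x * pd i (fun w => f t x w) v

/-- The energy `𝓔_N[f](t) = Σ_{|α| ≤ N} ‖Z^α f‖_{L¹(ℝⁿ_x × ℝⁿ_v)}`. -/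
def energy (n N : ℕ) (f : ℝ → E n → E n → ℝ) (t : ℝ) : ℝ :=
  ∑ m ∈ Finset.range (N + 1), ∑ α : Fin m → VFIdx n,
    ∫ x : E n, ∫ v : E n, |microList (List.ofFn α) f t x v|

/-- Smoothness of a function of `(t,x,v)`. -/
def SmoothTXV (n : ℕ) (f : ℝ → E n → E n → ℝ) : Prop :=
  ContDiff ℝ (⊤ : ℕ∞) (fun p : ℝ × E n × E n => f p.1 p.2.1 p.2.2)

/-- Smoothness of a function of `(t,x)`. -/
def SmoothTX (n : ℕ) (φ : ℝ → E n → ℝ) : Prop :=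
  ContDiff ℝ (⊤ : ℕ∞) (fun p : ℝ × E n => φ p.1 p.2)

/-- The modified Bessel function of the second kind `K_ν(r)`. -/
def Kfun (ν r : ℝ) : ℝ :=
  ∫ l in Set.Ioi (0 : ℝ), Real.exp (-(r * Real.cosh l)) * Real.cosh (ν * l)

/-- The Yukawa Green's function `G₁(x) = c |x|^{1-n/2} K_{n/2-1}(|x|)`. -/
def Gyukawa (n : ℕ) (c : ℝ) (x : E n) : ℝ :=
  c * ‖x‖ ^ ((1 : ℝ) - (n : ℝ) / 2) * Kfun ((n : ℝ) / 2 - 1) ‖x‖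

/-- Convolution of two scalar functions on `ℝⁿ`. -/
def conv (g h : E n → ℝ) (x : E n) : ℝ := ∫ y : E n, g (x - y) * h y

/-- `k`-fold convolution with `g` (the `0`-fold one being the identity). -/
def convIter (g : E n → ℝ) : ℕ → (E n → ℝ) → E n → ℝ
  | 0, h => h
  | m + 1, h => conv g (convIter g m h)


open scoped ContDiff

/-- Action of a macroscopic field at fixed time. -/
def zop (t : ℝ) (Z : VFIdx n) (g : E n → ℝ) : E n → ℝ := macroApply Z (fun _ => g) t

def zlist (t : ℝ) (L : List (VFIdx n)) (g : E n → ℝ) : E n → ℝ := L.foldr (zop t) g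

lemma macroList_eq (t : ℝ) (L : List (VFIdx n)) (g : E n → ℝ) :
    macroList L (fun _ z => g z) t = zlist t L g := by
  induction L with
  | nil => rfl
  | cons Z L ih =>
    have : macroList (Z :: L) (fun _ z => g z) t
        = zop t Z (macroList L (fun _ z => g z) t) := by
      funext x
      simp only [macroList, zop, List.foldr_cons]
      rcases Z with i | i | p | u <;> rfl
    rw [this, ih]; rfl

lemma zop_form (t : ℝ) (Z : VFIdx n) : ∃ (A : E n →L[ℝ] E n) (b : E n),
    (∀ g x, zop t Z g x = fderiv ℝ g x (A x + b)) ∧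
    ∀ i j, |(A (EuclideanSpace.single i 1)) j| ≤ 1 := by
  rcases Z with k | k | ⟨⟨p, q⟩, hpq⟩ | u
  · refine ⟨0, EuclideanSpace.single k 1, fun g x => ?_, fun i j => by simp⟩
    simp [zop, macroApply, pd]
  · refine ⟨0, t • EuclideanSpace.single k 1, fun g x => ?_, fun i j => by simp⟩
    simp [zop, macroApply, pd]
  · refine ⟨(EuclideanSpace.proj p : E n →L[ℝ] ℝ).smulRight (EuclideanSpace.single q 1)
      - (EuclideanSpace.proj q : E n →L[ℝ] ℝ).smulRight (EuclideanSpace.single p 1), 0,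
      fun g x => ?_, fun i j => ?_⟩
    · simp [zop, macroApply, pd]
    · have hne : p ≠ q := ne_of_lt hpq
      by_cases h1 : p = i
      · by_cases h2 : q = i
        · exact absurd (h1.trans h2.symm) hne
        · by_cases h3 : j = q <;> simp [h1, h2, h3]
      · by_cases h2 : q = i
        · by_cases h3 : j = p <;> simp [h1, h2, h3]
        · simp [h1, h2]
  · refine ⟨ContinuousLinearMap.id ℝ _, 0, fun g x => ?_, fun i j => ?_⟩
    · simp only [zop, macroApply, pd, ContinuousLinearMap.id_apply, add_zero]
      have hx : x = ∑ i, x i • (EuclideanSpace.single i (1:ℝ) : E n) := by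
        ext j; simp [Finset.sum_apply, Pi.single_apply]
      conv_rhs => rw [hx]
      rw [map_sum, ← hx]; simp
    · simp only [ContinuousLinearMap.id_apply, PiLp.single_apply]
      split_ifs <;> simp

lemma pd_smooth (i : Fin n) {g : E n → ℝ} (hg : ContDiff ℝ ∞ g) : ContDiff ℝ ∞ (pd i g) := by
  have : ContDiff ℝ ∞ (fderiv ℝ g) := hg.fderiv_right (by simp)
  exact this.clm_apply contDiff_const

lemma zop_smooth (t : ℝ) (Z : VFIdx n) {g : E n → ℝ} (hg : ContDiff ℝ ∞ g) :
    ContDiff ℝ ∞ (zop t Z g) := by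
  obtain ⟨A, b, h, -⟩ := zop_form t Z
  rw [show zop t Z g = fun x => fderiv ℝ g x (A x + b) from funext (h g)]
  have : ContDiff ℝ ∞ (fderiv ℝ g) := hg.fderiv_right (by simp)
  exact this.clm_apply (A.contDiff.add contDiff_const)

lemma zlist_smooth (t : ℝ) (L : List (VFIdx n)) {g : E n → ℝ} (hg : ContDiff ℝ ∞ g) :
    ContDiff ℝ ∞ (zlist t L g) := by
  induction L with
  | nil => exact hg
  | cons Z L ih => exact zop_smooth t Z ih

lemma zop_supp (t : ℝ) (Z : VFIdx n) {g : E n → ℝ} (hg : HasCompactSupport g) :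
    HasCompactSupport (zop t Z g) := by
  obtain ⟨A, b, h, -⟩ := zop_form t Z
  refine (hg.fderiv (𝕜 := ℝ)).mono fun x hx => ?_
  rw [Function.mem_support] at hx ⊢
  intro h0
  exact hx (by rw [h, h0]; simp)

lemma zlist_supp (t : ℝ) (L : List (VFIdx n)) {g : E n → ℝ} (hg : HasCompactSupport g) :
    HasCompactSupport (zlist t L g) := by
  induction L with
  | nil => exact hg
  | cons Z L ih => exact zop_supp t Z ih

lemma smooth_diff {g : E n → ℝ} (hg : ContDiff ℝ ∞ g) (x : E n) : DifferentiableAt ℝ g x :=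
  (hg.differentiable (by simp)) x

lemma zop_sub (t : ℝ) (Z : VFIdx n) {f g : E n → ℝ} (hf : ContDiff ℝ ∞ f)
    (hg : ContDiff ℝ ∞ g) : zop t Z (fun x => f x - g x) = fun x => zop t Z f x - zop t Z g x := by
  obtain ⟨A, b, h, -⟩ := zop_form t Z
  funext x
  rw [h, h, h, fderiv_fun_sub (smooth_diff hf x) (smooth_diff hg x)]; rfl

lemma zop_sum (t : ℝ) (Z : VFIdx n) (c : Fin n → ℝ) {g : Fin n → E n → ℝ}
    (hg : ∀ i, ContDiff ℝ ∞ (g i)) :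
    zop t Z (fun x => ∑ i, c i * g i x) = fun x => ∑ i, c i * zop t Z (g i) x := by
  obtain ⟨A, b, h, -⟩ := zop_form t Z
  funext x
  rw [h, fderiv_fun_sum (fun i _ => (smooth_diff (hg i) x).const_mul _)]
  simp [h, fderiv_const_mul (smooth_diff (hg _) x)]

lemma zlist_comb (t : ℝ) (L : List (VFIdx n)) (c : Fin n → ℝ) {f : E n → ℝ} {g : Fin n → E n → ℝ}
    (hf : ContDiff ℝ ∞ f) (hg : ∀ i, ContDiff ℝ ∞ (g i)) :
    zlist t L (fun x => f x - ∑ i, c i * g i x)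
      = fun x => zlist t L f x - ∑ i, c i * zlist t L (g i) x := by
  induction L with
  | nil => rfl
  | cons Z L ih =>
    change zop t Z (zlist t L _) = fun x => zop t Z (zlist t L f) x
      - ∑ i, c i * zop t Z (zlist t L (g i)) x
    rw [ih, zop_sub t Z (zlist_smooth t L hf)
      (ContDiff.sum fun i _ => contDiff_const.mul (zlist_smooth t L (hg i))),
      zop_sum t Z c (fun i => zlist_smooth t L (hg i))]

lemma zop_comm (t : ℝ) (Z : VFIdx n) (i : Fin n) : ∃ c : Fin n → ℝ, (∀ j, |c j| ≤ 1) ∧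
    ∀ g : E n → ℝ, ContDiff ℝ ∞ g →
      zop t Z (pd i g) = fun x => pd i (zop t Z g) x - ∑ j, c j * pd j g x := by
  obtain ⟨A, b, h, hA⟩ := zop_form t Z
  refine ⟨fun j => (A (EuclideanSpace.single i 1)) j, fun j => hA i j, fun g hg => ?_⟩
  funext x
  have hd : ContDiff ℝ ∞ (fderiv ℝ g) := hg.fderiv_right (by simp)
  have hdx : DifferentiableAt ℝ (fderiv ℝ g) x := hd.differentiable (by simp) x
  have hsymm : IsSymmSndFDerivAt ℝ g x :=
    (hg.contDiffAt).isSymmSndFDerivAt (by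
      simp only [minSmoothness_of_isRCLikeNormedField]
      exact WithTop.coe_le_coe.2 (le_top : (2 : ℕ∞) ≤ ⊤))
  have h1 : zop t Z (pd i g) x = fderiv ℝ (fderiv ℝ g) x (A x + b) (EuclideanSpace.single i 1) := by
    rw [h]
    unfold pd
    rw [fderiv_clm_apply hdx (differentiableAt_const _)]
    simp
  have h2 : pd i (zop t Z g) x = fderiv ℝ (fderiv ℝ g) x (EuclideanSpace.single i 1) (A x + b)
      + fderiv ℝ g x (A (EuclideanSpace.single i 1)) := by
    rw [show zop t Z g = fun x => fderiv ℝ g x (A x + b) from funext (h g)]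
    unfold pd
    rw [fderiv_clm_apply hdx (A.differentiableAt.add_const b)]
    rw [fderiv_add_const, A.fderiv]
    simp [add_comm]
  have h3 : fderiv ℝ g x (A (EuclideanSpace.single i 1))
      = ∑ j, (A (EuclideanSpace.single i 1)) j * pd j g x := by
    generalize A (EuclideanSpace.single i 1) = v
    have hv : v = ∑ i, v i • (EuclideanSpace.single i (1:ℝ) : E n) := by
      ext j; simp [Finset.sum_apply, Pi.single_apply]
    conv_lhs => rw [hv]
    rw [map_sum]; simp [pd]
  rw [h1, h2, h3, hsymm.eq]
  ring

/-- first order pointwise bound -/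
lemma first_bound (t : ℝ) (ht : 0 ≤ t) (g : E n → ℝ) (y : E n) (M : ℝ)
    (hM : ∀ Z, |zop t Z g y| ≤ M) (i : Fin n) :
    (1 + t + ‖y‖) * |pd i g y| ≤ (n + 3) * M := by
  have h1 : |pd i g y| ≤ M := hM (Sum.inl i)
  have hM0 : 0 ≤ M := (abs_nonneg _).trans h1
  have h2 : t * |pd i g y| ≤ M := by
    have := hM (Sum.inr (Sum.inl i))
    simp only [zop, macroApply, abs_mul, abs_of_nonneg ht] at this
    exact this
  have hrot : ∀ j, |y j * pd i g y - y i * pd j g y| ≤ M := by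
    intro j
    rcases lt_trichotomy i j with hij | hij | hij
    · have := hM (Sum.inr (Sum.inr (Sum.inl ⟨(i, j), hij⟩)))
      simp only [zop, macroApply] at this
      rwa [abs_sub_comm]
    · subst hij; simpa using hM0
    · have := hM (Sum.inr (Sum.inr (Sum.inl ⟨(j, i), hij⟩)))
      simpa only [zop, macroApply] using this
  have hS : |∑ j, y j * pd j g y| ≤ M := hM (Sum.inr (Sum.inr (Sum.inr ())))
  have hle : ∀ j, |y j| ≤ ‖y‖ := fun j => by
    simpa using PiLp.norm_apply_le (p := 2) y j
  have hid : ‖y‖ ^ 2 * pd i g y = y i * (∑ j, y j * pd j g y)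
      + ∑ j, y j * (y j * pd i g y - y i * pd j g y) := by
    rw [EuclideanSpace.norm_sq_eq, Finset.sum_mul, Finset.mul_sum, ← Finset.sum_add_distrib]
    refine Finset.sum_congr rfl fun j _ => ?_
    rw [Real.norm_eq_abs, sq_abs]; ring
  have h3 : ‖y‖ ^ 2 * |pd i g y| ≤ ‖y‖ * ((n + 1) * M) := by
    calc ‖y‖ ^ 2 * |pd i g y| = |‖y‖ ^ 2 * pd i g y| := by
          rw [abs_mul, abs_of_nonneg (sq_nonneg ‖y‖)]
      _ ≤ |y i * (∑ j, y j * pd j g y)| + |∑ j, y j * (y j * pd i g y - y i * pd j g y)| := by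
          rw [hid]; exact abs_add_le _ _
      _ ≤ ‖y‖ * M + ∑ j : Fin n, ‖y‖ * M := by
          refine add_le_add ?_ ((Finset.abs_sum_le_sum_abs _ _).trans
            (Finset.sum_le_sum fun j _ => ?_))
          · rw [abs_mul]; exact mul_le_mul (hle i) hS (abs_nonneg _) (norm_nonneg _)
          · rw [abs_mul]; exact mul_le_mul (hle j) (hrot j) (abs_nonneg _) (norm_nonneg _)
      _ = ‖y‖ * ((n + 1) * M) := by simp; ring
  have h4 : ‖y‖ * |pd i g y| ≤ (n + 1) * M := by
    rcases (norm_nonneg y).eq_or_lt with h0 | h0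
    · rw [← h0]; simp; positivity
    · refine le_of_mul_le_mul_left ?_ h0
      calc _ = ‖y‖ ^ 2 * |pd i g y| := by ring
        _ ≤ _ := h3
  nlinarith

lemma zlist_append (t : ℝ) (L : List (VFIdx n)) (Z : VFIdx n) (g : E n → ℝ) :
    zlist t (L ++ [Z]) g = zlist t L (zop t Z g) := by
  simp [zlist]

lemma comm_bound (k : ℕ) : ∃ C : ℝ, 0 ≤ C ∧ ∀ (t : ℝ), 0 ≤ t → ∀ (g : E n → ℝ),
    ContDiff ℝ ∞ g → ∀ (y : E n) (M : ℝ),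
    (∀ L : List (VFIdx n), L.length ≤ k + 1 → |zlist t L g y| ≤ M) →
    ∀ (i : Fin n) (L : List (VFIdx n)), L.length = k →
      (1 + t + ‖y‖) * |zlist t L (pd i g) y| ≤ C * M := by
  induction k with
  | zero =>
    refine ⟨n + 3, by positivity, fun t ht g hg y M hM i L hL => ?_⟩
    rw [List.length_eq_zero_iff] at hL
    subst hL
    exact first_bound t ht g y M (fun Z => hM [Z] (by simp)) i
  | succ k ih =>
    obtain ⟨C, hC, ih⟩ := ih
    refine ⟨C + n * C, by positivity, fun t ht g hg y M hM i L hL => ?_⟩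
    obtain ⟨L', Z, rfl⟩ : ∃ L' Z, L = L' ++ [Z] := by
      have hne : L ≠ [] := by rintro rfl; simp at hL
      exact ⟨L.dropLast, L.getLast hne, (List.dropLast_append_getLast hne).symm⟩
    have hL' : L'.length = k := by simpa using hL
    obtain ⟨c, hc, hcomm⟩ := zop_comm t Z i
    rw [zlist_append, hcomm g hg, zlist_comb t L' c (pd_smooth i (zop_smooth t Z hg))
      (fun j => pd_smooth j hg)]
    have hR : 0 ≤ 1 + t + ‖y‖ := by positivity
    have hA := ih t ht (zop t Z g) (zop_smooth t Z hg) y M (fun L hL => by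
      rw [← zlist_append]; exact hM _ (by simpa using hL)) i L' hL'
    have hB : ∀ j, (1 + t + ‖y‖) * |zlist t L' (pd j g) y| ≤ C * M := fun j =>
      ih t ht g hg y M (fun L hL => hM _ (by omega)) j L' hL'
    calc _ ≤ (1 + t + ‖y‖) * (|zlist t L' (pd i (zop t Z g)) y|
              + ∑ j, |zlist t L' (pd j g) y|) := by
          refine mul_le_mul_of_nonneg_left ?_ hR
          refine (abs_sub _ _).trans (add_le_add le_rfl ?_)
          refine (Finset.abs_sum_le_sum_abs _ _).trans (Finset.sum_le_sum fun j _ => ?_)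
          rw [abs_mul]
          exact mul_le_of_le_one_left (abs_nonneg _) (hc j)
      _ = (1 + t + ‖y‖) * |zlist t L' (pd i (zop t Z g)) y|
              + ∑ j, (1 + t + ‖y‖) * |zlist t L' (pd j g) y| := by rw [mul_add, Finset.mul_sum]
      _ ≤ C * M + ∑ j : Fin n, C * M := add_le_add hA (Finset.sum_le_sum fun j _ => hB j)
      _ = (C + n * C) * M := by simp; ring

lemma pdList_append (L : List (Fin n)) (i : Fin n) (g : E n → ℝ) :
    pdList (L ++ [i]) g = pdList L (pd i g) := by
  simp [pdList]

lemma snoc_of_length {α : Type*} {L : List α} {k : ℕ} (hL : L.length = k + 1) :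
    ∃ L' a, L = L' ++ [a] ∧ L'.length = k := by
  have hne : L ≠ [] := by rintro rfl; simp at hL
  exact ⟨L.dropLast, L.getLast hne, (List.dropLast_append_getLast hne).symm, by simp [hL]⟩

lemma comm_bound_le (k : ℕ) : ∃ C : ℝ, 0 ≤ C ∧ ∀ (t : ℝ), 0 ≤ t → ∀ (g : E n → ℝ),
    ContDiff ℝ ∞ g → ∀ (y : E n) (M : ℝ),
    (∀ L : List (VFIdx n), L.length ≤ k + 1 → |zlist t L g y| ≤ M) →
    ∀ (i : Fin n) (L : List (VFIdx n)), L.length ≤ k →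
      (1 + t + ‖y‖) * |zlist t L (pd i g) y| ≤ C * M := by
  choose C hC h using comm_bound (n := n)
  refine ⟨∑ j ∈ Finset.range (k + 1), C j, Finset.sum_nonneg fun j _ => hC j,
    fun t ht g hg y M hM i L hL => ?_⟩
  have hM0 : 0 ≤ M := (abs_nonneg _).trans (hM [] (by simp))
  refine (h L.length t ht g hg y M (fun L' hL' => hM L' (by omega)) i L rfl).trans
    (mul_le_mul_of_nonneg_right ?_ hM0)
  exact Finset.single_le_sum (f := C) (fun j _ => hC j) (Finset.mem_range.2 (by omega))

lemma pdList_bound (k : ℕ) : ∃ C : ℝ, 0 ≤ C ∧ ∀ (t : ℝ), 0 ≤ t → ∀ (g : E n → ℝ),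
    ContDiff ℝ ∞ g → ∀ (y : E n) (M : ℝ),
    (∀ L : List (VFIdx n), L.length ≤ k → |zlist t L g y| ≤ M) →
    ∀ (ds : List (Fin n)), ds.length = k →
      (1 + t + ‖y‖) ^ k * |pdList ds g y| ≤ C * M := by
  induction k with
  | zero =>
    refine ⟨1, by positivity, fun t ht g hg y M hM ds hds => ?_⟩
    rw [List.length_eq_zero_iff] at hds
    subst hds
    simpa [pdList, zlist] using hM [] (by simp)
  | succ k ih =>
    obtain ⟨C, hC, ih⟩ := ih
    obtain ⟨D, hD, hcb⟩ := comm_bound_le (n := n) k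
    refine ⟨C * D, by positivity, fun t ht g hg y M hM ds hds => ?_⟩
    obtain ⟨ds', i, rfl, hds'⟩ := snoc_of_length hds
    have hR : 0 < 1 + t + ‖y‖ := by positivity
    have := ih t ht (pd i g) (pd_smooth i hg) y (D * M / (1 + t + ‖y‖)) (fun L hL => by
      rw [le_div_iff₀ hR, mul_comm]
      exact hcb t ht g hg y M hM i L hL) ds' hds'
    rw [pdList_append, pow_succ, mul_right_comm]
    calc _ ≤ C * (D * M / (1 + t + ‖y‖)) * (1 + t + ‖y‖) :=
          mul_le_mul_of_nonneg_right this hR.le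
      _ = _ := by field_simp

lemma pdList_bound_le (k : ℕ) : ∃ C : ℝ, 0 < C ∧ ∀ (t : ℝ), 0 ≤ t → ∀ (g : E n → ℝ),
    ContDiff ℝ ∞ g → ∀ (y : E n) (M : ℝ),
    (∀ L : List (VFIdx n), L.length ≤ k → |zlist t L g y| ≤ M) →
    ∀ (ds : List (Fin n)), ds.length ≤ k →
      (1 + t + ‖y‖) ^ ds.length * |pdList ds g y| ≤ C * M := by
  choose C hC h using pdList_bound (n := n)
  refine ⟨(∑ j ∈ Finset.range (k + 1), C j) + 1, by
    have := Finset.sum_nonneg (s := Finset.range (k+1)) fun j _ => hC j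
    linarith, fun t ht g hg y M hM L hL => ?_⟩
  have hM0 : 0 ≤ M := (abs_nonneg _).trans (hM [] (by simp))
  refine (h L.length t ht g hg y M (fun L' hL' => hM L' (by omega)) L rfl).trans
    (mul_le_mul_of_nonneg_right ?_ hM0)
  have := Finset.single_le_sum (f := C) (fun j _ => hC j)
    (Finset.mem_range.2 (show L.length < k + 1 by omega))
  linarith

lemma one_dim (f f' : ℝ → ℝ) (hf : ∀ u, HasDerivAt f (f' u) u) (hf' : Continuous f') (a b p : ℝ)
    (ha : 0 < a) (hp : p ∈ Set.Icc b (b + a)) :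
    ENNReal.ofReal (a * |f p|) ≤ ∫⁻ u in Set.Icc b (b + a), ENNReal.ofReal (|f u| + a * |f' u|) := by
  have hfc : Continuous f := continuous_iff_continuousAt.2 fun u => (hf u).continuousAt
  have hint : ∀ h : ℝ → ℝ, Continuous h → IntegrableOn h (Set.Icc b (b + a)) := fun h hh =>
    hh.continuousOn.integrableOn_compact isCompact_Icc
  rw [← ofReal_integral_eq_lintegral_ofReal (hint _ (by fun_prop))
    (Filter.Eventually.of_forall fun u => by positivity)]
  refine ENNReal.ofReal_le_ofReal ?_
  set J := ∫ u in Set.Icc b (b + a), |f' u| with hJ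
  have key : ∀ u ∈ Set.Icc b (b + a), |f p| ≤ |f u| + J := by
    intro u hu
    have h1 : ∫ v in u..p, f' v = f p - f u :=
      intervalIntegral.integral_eq_sub_of_hasDerivAt (fun v _ => hf v) (hf'.intervalIntegrable _ _)
    have h2 : |f p - f u| ≤ J := by
      rw [← h1]
      refine (intervalIntegral.norm_integral_le_integral_norm_uIoc (f := f') (a := u) (b := p)
        (μ := volume)).trans ?_
      refine setIntegral_mono_set (hint _ hf'.abs)
        (Filter.Eventually.of_forall fun u => abs_nonneg _) (HasSubset.Subset.eventuallyLE ?_)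
      exact Set.uIoc_subset_uIcc.trans (Set.uIcc_subset_Icc hu hp)
    have := abs_sub_abs_le_abs_sub (f p) (f u)
    linarith
  have hvol : volume.real (Set.Icc b (b + a)) = a := by
    rw [Real.volume_real_Icc_of_le (by linarith)]; ring
  calc a * |f p| = ∫ u in Set.Icc b (b + a), |f p| := by
        rw [setIntegral_const, hvol, smul_eq_mul]
    _ ≤ ∫ u in Set.Icc b (b + a), (|f u| + J) :=
        setIntegral_mono_on (hint _ continuous_const) (hint _ (by fun_prop)) measurableSet_Icc key
    _ = (∫ u in Set.Icc b (b + a), |f u|) + a * J := by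
        rw [integral_add (hint _ (by fun_prop)) (hint _ continuous_const), setIntegral_const, hvol,
          smul_eq_mul]
    _ = ∫ u in Set.Icc b (b + a), (|f u| + a * |f' u|) := by
        rw [integral_add (hint _ (by fun_prop)) (hint _ (by fun_prop)), integral_const_mul]

lemma cube_bound (x₀ : Fin n → ℝ) (a : ℝ) (ha : 0 < a) (F : (Fin n → ℝ) → ENNReal)
    (hF : Measurable F) (s : Finset (Fin n)) : ∀ (c : ℝ), 0 ≤ c → ∀ (g : E n → ℝ), ContDiff ℝ ∞ g →
    (∀ z : Fin n → ℝ, (∀ i, z i ∈ Set.Icc (x₀ i) (x₀ i + a)) → ∀ L : List (Fin n),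
      L.length ≤ s.card → ENNReal.ofReal (c * (a ^ L.length * |pdList L g (WithLp.toLp 2 z)|)) ≤ F z) →
    ∀ x : Fin n → ℝ, (∀ i, x i ∈ Set.Icc (x₀ i) (x₀ i + a)) →
      ENNReal.ofReal (c * (a ^ s.card * |g (WithLp.toLp 2 x)|)) ≤
        2 ^ s.card * lmarginal (fun i => volume.restrict (Set.Icc (x₀ i) (x₀ i + a))) s F x := by
  induction s using Finset.induction with
  | empty =>
    intro c hc g hg h x hx
    simpa [pdList] using h x hx [] (by simp)
  | insert i s hi ih =>
    intro c hc g hg h x hx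
    rw [lmarginal_insert F hF hi, Finset.card_insert_of_notMem hi] at *
    set k := s.card
    have hder : ∀ u, HasDerivAt (fun u => g (WithLp.toLp 2 (Function.update x i u)))
        (pd i g (WithLp.toLp 2 (Function.update x i u))) u := by
      intro u
      have h1 := hasDerivAt_update x i u
      have h2 : HasDerivAt (fun u => (WithLp.toLp 2 (Function.update x i u) : E n))
          (EuclideanSpace.single i 1) u :=
        ((PiLp.continuousLinearEquiv 2 ℝ (fun _ : Fin n => ℝ)).symm.hasFDerivAt).comp_hasDerivAt u h1
      exact (smooth_diff hg _).hasFDerivAt.comp_hasDerivAt u h2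
    have hcu : Continuous (fun u => (WithLp.toLp 2 (Function.update x i u) : E n)) :=
      (PiLp.continuous_toLp 2 _).comp (continuous_const.update i continuous_id)
    have h1 := one_dim _ _ hder ((pd_smooth i hg).continuous.comp hcu) a (x₀ i) (x i) ha (hx i)
    rw [Function.update_eq_self] at h1
    have hck : 0 ≤ c * a ^ k := by positivity
    calc ENNReal.ofReal (c * (a ^ (k + 1) * |g (WithLp.toLp 2 x)|))
        = ENNReal.ofReal (c * a ^ k) * ENNReal.ofReal (a * |g (WithLp.toLp 2 x)|) := by
          rw [← ENNReal.ofReal_mul hck]; congr 1; ring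
      _ ≤ ENNReal.ofReal (c * a ^ k) * (∫⁻ u in Set.Icc (x₀ i) (x₀ i + a),
            ENNReal.ofReal (|g (WithLp.toLp 2 (Function.update x i u))|
              + a * |pd i g (WithLp.toLp 2 (Function.update x i u))|)) := by gcongr
      _ = ∫⁻ u in Set.Icc (x₀ i) (x₀ i + a), ENNReal.ofReal (c * a ^ k) *
            ENNReal.ofReal (|g (WithLp.toLp 2 (Function.update x i u))|
              + a * |pd i g (WithLp.toLp 2 (Function.update x i u))|) := by
          rw [lintegral_const_mul' _ _ ENNReal.ofReal_ne_top]
      _ ≤ ∫⁻ u in Set.Icc (x₀ i) (x₀ i + a), 2 ^ (k + 1) *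
            lmarginal (fun i => volume.restrict (Set.Icc (x₀ i) (x₀ i + a))) s F
              (Function.update x i u) := by
          refine setLIntegral_mono' measurableSet_Icc fun u hu => ?_
          have hxu : ∀ j, Function.update x i u j ∈ Set.Icc (x₀ j) (x₀ j + a) := by
            intro j
            by_cases hj : j = i
            · subst hj; simpa using hu
            · simpa [hj] using hx j
          have hA := ih c hc g hg (fun z hz L hL => h z hz L (by omega)) _ hxu
          have hB := ih (c * a) (by positivity) (pd i g) (pd_smooth i hg) (fun z hz L hL => by
            have := h z hz (L ++ [i]) (by simpa using hL)
            rw [pdList_append] at this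
            refine le_trans (le_of_eq ?_) this
            congr 1
            simp [pow_succ]
            ring) _ hxu
          rw [← ENNReal.ofReal_mul hck]
          calc _ = ENNReal.ofReal (c * (a ^ k * |g (WithLp.toLp 2 (Function.update x i u))|))
                + ENNReal.ofReal (c * a *
                  (a ^ k * |pd i g (WithLp.toLp 2 (Function.update x i u))|)) := by
                rw [← ENNReal.ofReal_add (by positivity) (by positivity)]; congr 1; ring
            _ ≤ _ := add_le_add hA hB
            _ = _ := by rw [pow_succ]; ring
      _ = _ := by rw [lintegral_const_mul' _ _ (by simp)]

/-- the L¹ Klainerman–Sobolev inequality. -/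
theorem klainerman_sobolev_L1 (n : ℕ) (hn : 1 ≤ n) :
    ∃ C : ℝ, 0 < C ∧
      ∀ t : ℝ, 0 ≤ t → ∀ ψ : E n → ℝ, ContDiff ℝ (⊤ : ℕ∞) ψ → HasCompactSupport ψ →
        ∀ x : E n,
          |ψ x| ≤ C / (1 + t + ‖x‖) ^ n *
            ∑ m ∈ Finset.range (n + 1), ∑ β : Fin m → VFIdx n,
              ∫ y : E n, |macroList (List.ofFn β) (fun _ z => ψ z) t y| := by
  obtain ⟨C, hC, hb⟩ := pdList_bound_le (n := n) n
  have hn0 : (0 : ℝ) < n := by exact_mod_cast hn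
  refine ⟨2 ^ n * C * (2 * n) ^ n, by positivity, fun t ht ψ hψ hsupp x => ?_⟩
  simp only [macroList_eq]
  set R := 1 + t + ‖x‖ with hR
  have hR0 : 0 < R := by positivity
  set a := R / (2 * n) with ha
  have ha0 : 0 < a := by positivity
  set S : E n → ℝ := fun y => ∑ m ∈ Finset.range (n + 1), ∑ β : Fin m → VFIdx n,
    |zlist t (List.ofFn β) ψ y| with hS
  have hterm : ∀ L : List (VFIdx n), Integrable (fun y => |zlist t L ψ y|) := fun L =>
    ((zlist_smooth t L hψ).continuous.integrable_of_hasCompactSupport (zlist_supp t L hsupp)).abs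
  have hSint : Integrable S := integrable_finsetSum _ fun m _ =>
    integrable_finsetSum _ fun β _ => hterm _
  have hSc : Continuous S := continuous_finsetSum _ fun m _ =>
    continuous_finsetSum _ fun β _ => (zlist_smooth t _ hψ).continuous.abs
  have hS0 : ∀ y, 0 ≤ S y := fun y => Finset.sum_nonneg fun m _ =>
    Finset.sum_nonneg fun β _ => abs_nonneg _
  have hSI : ∫ y, S y = ∑ m ∈ Finset.range (n + 1), ∑ β : Fin m → VFIdx n,
      ∫ y, |zlist t (List.ofFn β) ψ y| := by
    rw [hS, integral_finsetSum _ fun m _ => integrable_finsetSum _ fun β _ => hterm _]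
    refine Finset.sum_congr rfl fun m _ => ?_
    rw [integral_finsetSum _ fun β _ => hterm _]
  rw [← hSI]
  have hSle : ∀ y (L : List (VFIdx n)), L.length ≤ n → |zlist t L ψ y| ≤ S y := by
    intro y L hL
    have h1 : |zlist t L ψ y| ≤ ∑ β : Fin L.length → VFIdx n, |zlist t (List.ofFn β) ψ y| := by
      have := Finset.single_le_sum (s := Finset.univ)
        (f := fun β : Fin L.length → VFIdx n => |zlist t (List.ofFn β) ψ y|)
        (fun β _ => abs_nonneg _) (Finset.mem_univ L.get)
      simpa using this
    refine h1.trans ?_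
    exact Finset.single_le_sum (s := Finset.range (n + 1))
      (f := fun m => ∑ β : Fin m → VFIdx n, |zlist t (List.ofFn β) ψ y|)
      (fun m _ => Finset.sum_nonneg fun β _ => abs_nonneg _) (Finset.mem_range.2 (by omega))
  have hF : Measurable (fun z : Fin n → ℝ => ENNReal.ofReal (C * S (WithLp.toLp 2 z))) :=
    (Continuous.measurable (by
      exact continuous_const.mul (hSc.comp (PiLp.continuous_toLp 2 _)))).ennreal_ofReal
  have hmain := cube_bound x.ofLp a ha0 _ hF Finset.univ 1 zero_le_one ψ hψ (by
    intro z hz L hL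
    refine ENNReal.ofReal_le_ofReal ?_
    rw [one_mul]
    have hL' : L.length ≤ n := by simpa using hL
    refine le_trans ?_ (hb t ht ψ hψ (WithLp.toLp 2 z) _ (hSle _) L hL')
    refine mul_le_mul_of_nonneg_right (pow_le_pow_left₀ ha0.le ?_ _) (abs_nonneg _)
    have hd : ‖x - WithLp.toLp 2 z‖ ≤ n * a := by
      refine le_of_sq_le_sq ?_ (by positivity)
      rw [EuclideanSpace.norm_sq_eq]
      calc _ ≤ ∑ i : Fin n, a ^ 2 := by
            refine Finset.sum_le_sum fun i _ => ?_
            refine pow_le_pow_left₀ (norm_nonneg _) ?_ 2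
            have := hz i
            rw [Real.norm_eq_abs, abs_le]
            simp only [PiLp.sub_apply]
            constructor <;> linarith [this.1, this.2]
        _ = n * a ^ 2 := by simp
        _ ≤ (n * a) ^ 2 := by
            have : (1 : ℝ) ≤ n := by exact_mod_cast hn
            rw [mul_pow]
            refine mul_le_mul_of_nonneg_right ?_ (sq_nonneg a)
            nlinarith
    have h1 : n * a = R / 2 := by rw [ha]; field_simp
    have h2 : a ≤ n * a := by
      have : (1 : ℝ) ≤ n := by exact_mod_cast hn
      nlinarith
    have h3 : ‖x‖ ≤ ‖x - WithLp.toLp 2 z‖ + ‖(WithLp.toLp 2 z : E n)‖ := by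
      simpa using norm_add_le (x - WithLp.toLp 2 z) (WithLp.toLp 2 z)
    linarith) x.ofLp (fun i => ⟨le_rfl, by linarith⟩)
  have hint : lmarginal (fun i => volume.restrict (Set.Icc (x.ofLp i) (x.ofLp i + a))) Finset.univ
      (fun z : Fin n → ℝ => ENNReal.ofReal (C * S (WithLp.toLp 2 z))) x.ofLp
      ≤ ENNReal.ofReal (C * ∫ y, S y) := by
    rw [lmarginal_univ, ← Measure.restrict_pi_pi]
    refine (lintegral_mono' Measure.restrict_le_self le_rfl).trans ?_
    rw [← volume_pi, ← integral_const_mul, ofReal_integral_eq_lintegral_ofReal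
      (hSint.const_mul C) (Filter.Eventually.of_forall fun y => mul_nonneg hC.le (hS0 y))]
    refine le_of_eq ?_
    exact (PiLp.volume_preserving_toLp (Fin n)).lintegral_comp
      (f := fun y => ENNReal.ofReal (C * S y)) (by fun_prop)
  have hI0 : 0 ≤ ∫ y, S y := integral_nonneg hS0
  have hfin : a ^ n * |ψ x| ≤ 2 ^ n * (C * ∫ y, S y) := by
    have h := hmain.trans (mul_le_mul_right hint _)
    rw [Finset.card_univ, Fintype.card_fin, one_mul] at h
    have h2 : (2 : ENNReal) ^ n = ENNReal.ofReal (2 ^ n) := by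
      rw [ENNReal.ofReal_pow (by norm_num)]; simp
    rw [h2, ← ENNReal.ofReal_mul (by positivity),
      ENNReal.ofReal_le_ofReal_iff (by positivity)] at h
    exact h
  have hRa : R ^ n = (2 * n) ^ n * a ^ n := by
    rw [← mul_pow]; congr 1; rw [ha]; field_simp
  rw [div_mul_eq_mul_div, le_div_iff₀ (by positivity), hRa]
  have h2n : (0 : ℝ) ≤ (2 * n) ^ n := by positivity
  calc _ = (2 * n) ^ n * (a ^ n * |ψ x|) := by ring
    _ ≤ (2 * n) ^ n * (2 ^ n * (C * ∫ y, S y)) := mul_le_mul_of_nonneg_left hfin h2n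
    _ = _ := by ring
end
end

section
/- (Bilinear estimate for Vlasov–Poisson.) Let n ≥ 3 and N ≥ 2n. There exists a constant C, depending only on n and N, such that the following holds. Let t ≥ 0, ε > 0, let f : ℝⁿ_x × ℝⁿ_v → ℝ be smooth and compactly supported with Σ_{|α| ≤ N, Z^α ∈ γ^{|α|}} ‖Z^α f‖_{L¹(ℝⁿ_x × ℝⁿ_v)} ≤ 2ε, and let φ(x) = ∫ G₀(x−y) ρ(f)(y) dy. Then for all multi-indices γ, β with |γ| ≤ N, |β| ≤ N, |γ| + |β| ≤ N + 1, and all compositions Z^γ ∈ Γ^{|γ|}, Z^β ∈ γ^{|β|}: ‖∇ₓ(Z^γ φ) · Z^β f‖_{L¹(ℝⁿ_x × ℝⁿ_v)} ≤ C ε (1+t)^{−(n−1)} Σ_{|β'| ≤ N, Z^{β'} ∈ γ^{|β'|}} ‖Z^{β'} f‖_{L¹(ℝⁿ_x × ℝⁿ_v)}. -/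
noncomputable section

open MeasureTheory Real

variable {n : ℕ}

section Aux

open scoped ContDiff

open scoped ContDiff

def Nice (g : E n → E n → ℝ) : Prop :=
  ContDiff ℝ ∞ (fun p : E n × E n => g p.1 p.2) ∧
    HasCompactSupport (fun p : E n × E n => g p.1 p.2)

def dX (i : Fin n) (g : E n → E n → ℝ) : E n → E n → ℝ :=
  fun x v => pd i (fun y => g y v) x

def dV (i : Fin n) (g : E n → E n → ℝ) : E n → E n → ℝ :=
  fun x v => pd i (fun w => g x w) v

lemma Nice.differentiable {g : E n → E n → ℝ} (h : Nice g) :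
    Differentiable ℝ (fun p : E n × E n => g p.1 p.2) := h.1.differentiable (by simp)

lemma Nice.diff_x {g : E n → E n → ℝ} (h : Nice g) (v : E n) :
    Differentiable ℝ (fun y => g y v) :=
  h.differentiable.comp (f := fun y : E n => (y, v)) (by fun_prop)

lemma Nice.diff_v {g : E n → E n → ℝ} (h : Nice g) (x : E n) :
    Differentiable ℝ (fun w => g x w) :=
  h.differentiable.comp (f := fun w : E n => (x, w)) (by fun_prop)

lemma dX_eq {g : E n → E n → ℝ} (h : Nice g) (i : Fin n) (x v : E n) :
    dX i g x v = fderiv ℝ (fun p : E n × E n => g p.1 p.2) (x, v)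
      (EuclideanSpace.single i 1, 0) := by
  have h1 : HasFDerivAt (fun y : E n => (y, v)) (ContinuousLinearMap.inl ℝ (E n) (E n)) x :=
    hasFDerivAt_prodMk_left x v
  have := ((h.differentiable (x, v)).hasFDerivAt.comp x h1).fderiv
  unfold dX pd
  rw [show (fun y => g y v) = (fun p : E n × E n => g p.1 p.2) ∘ (fun y => (y, v)) from rfl, this]
  simp

lemma dV_eq {g : E n → E n → ℝ} (h : Nice g) (i : Fin n) (x v : E n) :
    dV i g x v = fderiv ℝ (fun p : E n × E n => g p.1 p.2) (x, v)
      (0, EuclideanSpace.single i 1) := by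
  have h1 : HasFDerivAt (fun y : E n => (x, y)) (ContinuousLinearMap.inr ℝ (E n) (E n)) v :=
    hasFDerivAt_prodMk_right x v
  have := ((h.differentiable (x, v)).hasFDerivAt.comp v h1).fderiv
  unfold dV pd
  rw [show (fun y => g x y) = (fun p : E n × E n => g p.1 p.2) ∘ (fun y => (x, y)) from rfl, this]
  simp

lemma nice_fderiv {g : E n → E n → ℝ} (h : Nice g) (w : E n × E n) :
    Nice (fun x v => fderiv ℝ (fun p : E n × E n => g p.1 p.2) (x, v) w) :=
  ⟨(h.1.fderiv_right (m := ∞) (by simp)).clm_apply contDiff_const, h.2.fderiv_apply (𝕜 := ℝ) w⟩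

lemma Nice.dX {g : E n → E n → ℝ} (h : Nice g) (i : Fin n) : Nice (dX i g) := by
  have := funext fun x => funext fun v => dX_eq h i x v
  rw [this]; exact nice_fderiv h _

lemma Nice.dV {g : E n → E n → ℝ} (h : Nice g) (i : Fin n) : Nice (dV i g) := by
  have := funext fun x => funext fun v => dV_eq h i x v
  rw [this]; exact nice_fderiv h _

lemma Nice.add {g k : E n → E n → ℝ} (h : Nice g) (h' : Nice k) :
    Nice (fun x v => g x v + k x v) := ⟨h.1.add h'.1, h.2.add h'.2⟩

lemma Nice.mul {g : E n → E n → ℝ} (h : Nice g) {a : E n → E n → ℝ}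
    (ha : ContDiff ℝ ∞ (fun p : E n × E n => a p.1 p.2)) :
    Nice (fun x v => a x v * g x v) := ⟨ha.mul h.1, h.2.mul_left⟩

lemma Nice.cmul {g : E n → E n → ℝ} (h : Nice g) (c : ℝ) :
    Nice (fun x v => c * g x v) := h.mul (a := fun _ _ => c) contDiff_const

lemma Nice.sub {g k : E n → E n → ℝ} (h : Nice g) (h' : Nice k) :
    Nice (fun x v => g x v - k x v) := by
  have := h.add (h'.cmul (-1))
  convert this using 3; ring

lemma Nice.xmul {g : E n → E n → ℝ} (h : Nice g) (i : Fin n) :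
    Nice (fun x v => x i * g x v) := by
  refine h.mul (a := fun x _ => x i) ?_
  exact (EuclideanSpace.proj (𝕜 := ℝ) i).contDiff.comp contDiff_fst

lemma Nice.vmul {g : E n → E n → ℝ} (h : Nice g) (i : Fin n) :
    Nice (fun x v => v i * g x v) := by
  refine h.mul (a := fun _ v => v i) ?_
  exact (EuclideanSpace.proj (𝕜 := ℝ) i).contDiff.comp contDiff_snd

lemma nice_zero : Nice (fun _ _ : E n => (0 : ℝ)) := ⟨contDiff_const, HasCompactSupport.zero⟩

lemma nice_sum {ι : Type*} (s : Finset ι) (g : ι → E n → E n → ℝ) (h : ∀ i ∈ s, Nice (g i)) :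
    Nice (fun x v => ∑ i ∈ s, g i x v) := by
  classical
  induction s using Finset.induction_on with
  | empty => simpa using nice_zero
  | insert a s ha ih =>
    simp only [Finset.sum_insert ha]
    exact (h a (by simp)).add (ih fun i hi => h i (by simp [hi]))

/-- micro field at fixed time -/
def mic (t : ℝ) (Z : VFIdx n) (g : E n → E n → ℝ) : E n → E n → ℝ :=
  fun x v => microApply Z (fun _ => g) t x v

def micL (t : ℝ) (L : List (VFIdx n)) (g : E n → E n → ℝ) : E n → E n → ℝ :=
  L.foldr (mic t) g

lemma microApply_eq (t : ℝ) (Z : VFIdx n) (F : ℝ → E n → E n → ℝ) :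
    microApply Z F t = mic t Z (F t) := by
  funext x v
  rcases Z with i | i | i | i <;> rfl

lemma microList_eq (t : ℝ) (L : List (VFIdx n)) (F : ℝ → E n → E n → ℝ) :
    microList L F t = micL t L (F t) := by
  induction L with
  | nil => rfl
  | cons Z L ih =>
    change microApply Z (microList L F) t = mic t Z (micL t L (F t))
    rw [microApply_eq, ih]

lemma Nice.mic {g : E n → E n → ℝ} (h : Nice g) (t : ℝ) (Z : VFIdx n) : Nice (mic t Z g) := by
  rcases Z with i | i | p | u
  · exact h.dX i
  · exact ((h.dX i).cmul t).add (h.dV i)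
  · exact ((((h.dX p.1.2).xmul p.1.1).sub ((h.dX p.1.1).xmul p.1.2)).add
      ((h.dV p.1.2).vmul p.1.1)).sub ((h.dV p.1.1).vmul p.1.2)
  · exact (nice_sum Finset.univ _ fun i _ => (h.dX i).xmul i).add
      (nice_sum Finset.univ _ fun i _ => (h.dV i).vmul i)

lemma Nice.micL {g : E n → E n → ℝ} (h : Nice g) (t : ℝ) (L : List (VFIdx n)) :
    Nice (micL t L g) := by
  induction L with
  | nil => exact h
  | cons Z L ih => exact ih.mic t Z

lemma dX_lin {g k : E n → E n → ℝ} (h : Nice g) (h' : Nice k) (c : ℝ) (i : Fin n) (x v : E n) :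
    dX i (fun x v => g x v + c * k x v) x v = dX i g x v + c * dX i k x v := by
  unfold dX pd
  have := ((h.diff_x v x).hasFDerivAt.add (((h'.diff_x v x).hasFDerivAt).const_mul c)).fderiv
  rw [show (fun y => g y v + c * k y v) = ((fun y => g y v) + fun y => c * k y v) from rfl, this]
  simp

lemma dV_lin {g k : E n → E n → ℝ} (h : Nice g) (h' : Nice k) (c : ℝ) (i : Fin n) (x v : E n) :
    dV i (fun x v => g x v + c * k x v) x v = dV i g x v + c * dV i k x v := by
  unfold dV pd
  have := ((h.diff_v x v).hasFDerivAt.add (((h'.diff_v x v).hasFDerivAt).const_mul c)).fderiv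
  rw [show (fun y => g x y + c * k x y) = ((fun y => g x y) + fun y => c * k x y) from rfl, this]
  simp

lemma mic_inl (t : ℝ) (i : Fin n) (g : E n → E n → ℝ) (x v : E n) :
    mic t (Sum.inl i) g x v = dX i g x v := rfl
lemma mic_inr_inl (t : ℝ) (i : Fin n) (g : E n → E n → ℝ) (x v : E n) :
    mic t (Sum.inr (Sum.inl i)) g x v = t * dX i g x v + dV i g x v := rfl
lemma mic_rot (t : ℝ) (p : {p : Fin n × Fin n // p.1 < p.2}) (g : E n → E n → ℝ) (x v : E n) :
    mic t (Sum.inr (Sum.inr (Sum.inl p))) g x v = x p.1.1 * dX p.1.2 g x v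
      - x p.1.2 * dX p.1.1 g x v + v p.1.1 * dV p.1.2 g x v - v p.1.2 * dV p.1.1 g x v := rfl
lemma mic_scal (t : ℝ) (u : Unit) (g : E n → E n → ℝ) (x v : E n) :
    mic t (Sum.inr (Sum.inr (Sum.inr u))) g x v = (∑ i, x i * dX i g x v)
      + ∑ i, v i * dV i g x v := rfl

lemma mic_lin {g k : E n → E n → ℝ} (h : Nice g) (h' : Nice k) (c : ℝ) (t : ℝ) (Z : VFIdx n) :
    mic t Z (fun x v => g x v + c * k x v) = fun x v => mic t Z g x v + c * mic t Z k x v := by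
  funext x v
  rcases Z with i | i | p | u
  · simp only [mic_inl, dX_lin h h']
  · simp only [mic_inr_inl, dX_lin h h', dV_lin h h']; ring
  · simp only [mic_rot, dX_lin h h', dV_lin h h']; ring
  · simp only [mic_scal, dX_lin h h', dV_lin h h', mul_add, Finset.sum_add_distrib,
      Finset.mul_sum, mul_left_comm c]
    ring

lemma micL_lin {g k : E n → E n → ℝ} (h : Nice g) (h' : Nice k) (c : ℝ) (t : ℝ)
    (L : List (VFIdx n)) :
    micL t L (fun x v => g x v + c * k x v) = fun x v => micL t L g x v + c * micL t L k x v := by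
  induction L with
  | nil => rfl
  | cons Z L ih =>
    change mic t Z (micL t L _) = fun x v => mic t Z (micL t L g) x v + c * mic t Z (micL t L k) x v
    rw [ih, mic_lin (h.micL t L) (h'.micL t L)]

/-- constant of commutation -/
def cZ (Z : VFIdx n) : ℝ := match Z with
  | Sum.inr (Sum.inr (Sum.inr _)) => (n : ℝ) + 2
  | _ => 0

/-- corrected composition -/
def gL (t : ℝ) (L : List (VFIdx n)) (g : E n → E n → ℝ) : E n → E n → ℝ :=
  L.foldr (fun Z k x v => mic t Z k x v + cZ Z * k x v) g

lemma Nice.gL {g : E n → E n → ℝ} (h : Nice g) (t : ℝ) (L : List (VFIdx n)) :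
    Nice (gL t L g) := by
  induction L with
  | nil => exact h
  | cons Z L ih => exact (ih.mic t Z).add (ih.cmul _)

lemma micL_append (t : ℝ) (K L : List (VFIdx n)) (g : E n → E n → ℝ) :
    micL t (K ++ L) g = micL t K (micL t L g) := by
  simp [micL]


open scoped ENNReal

def nrm (g : E n → E n → ℝ) : ℝ := ∫ x : E n, ∫ v : E n, |g x v|
def Nrm (g : E n → E n → ℝ) : ℝ≥0∞ := ∫⁻ x : E n, ∫⁻ v : E n, ‖g x v‖ₑ

lemma Nice.integrable {g : E n → E n → ℝ} (h : Nice g) :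
    Integrable (fun p : E n × E n => g p.1 p.2) :=
  h.1.continuous.integrable_of_hasCompactSupport h.2

lemma Nice.Nrm_eq {g : E n → E n → ℝ} (h : Nice g) : Nrm g = ENNReal.ofReal (nrm g) := by
  have h1 : nrm g = ∫ p : E n × E n, ‖g p.1 p.2‖ := by
    rw [Measure.volume_eq_prod, integral_prod _ (by
      rw [← Measure.volume_eq_prod]; exact h.integrable.norm)]
    rfl
  rw [h1, ofReal_integral_norm_eq_lintegral_enorm h.integrable, Measure.volume_eq_prod,
    lintegral_prod _ (by exact h.1.continuous.enorm.measurable.aemeasurable)]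
  rfl

lemma nrm_nonneg (g : E n → E n → ℝ) : 0 ≤ nrm g :=
  integral_nonneg fun _ => integral_nonneg fun _ => abs_nonneg _

lemma Nice.slice {g : E n → E n → ℝ} (h : Nice g) (x : E n) :
    ContDiff ℝ ∞ (fun v => g x v) ∧ HasCompactSupport (fun v => g x v) := by
  refine ⟨h.1.comp (f := fun v : E n => (x, v)) (by fun_prop), ?_⟩
  refine h.2.comp_isClosedEmbedding (g := fun v : E n => (x, v)) ?_
  exact Topology.IsClosedEmbedding.of_continuous_injective_isClosedMap (by fun_prop)
    (fun a b hab => by simpa using hab) (isClosedMap_prodMk_left x)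

lemma Nice.line_compact {g : E n → E n → ℝ} (h : Nice g) (p w : E n × E n) (hw : w ≠ 0) :
    HasCompactSupport (fun s : ℝ => g (p + s • w).1 (p + s • w).2) := by
  refine h.2.comp_isClosedEmbedding (g := fun s : ℝ => p + s • w) ?_
  exact (Homeomorph.addLeft p).isClosedEmbedding.comp (isClosedEmbedding_smul_left hw)

lemma Nice.line_deriv {g : E n → E n → ℝ} (h : Nice g) (p w : E n × E n) (s : ℝ) :
    HasDerivAt (fun s : ℝ => g (p + s • w).1 (p + s • w).2)
      (fderiv ℝ (fun p : E n × E n => g p.1 p.2) (p + s • w) w) s := by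
  have h1 : HasDerivAt (fun s : ℝ => p + s • w) w s := by
    simpa using ((hasDerivAt_id s).smul_const w).const_add p
  exact (h.differentiable (p + s • w)).hasFDerivAt.comp_hasDerivAt s h1

lemma toLp_update (y : Fin n → ℝ) (i : Fin n) (s : ℝ) :
    (WithLp.toLp 2 (Function.update y i s) : E n) =
      WithLp.toLp 2 (Function.update y i 0) + s • EuclideanSpace.single i (1 : ℝ) := by
  ext j
  by_cases hj : j = i
  · subst hj; simp
  · simp [hj]

lemma sob_aux (t a b : ℝ) (hab : a ≠ 0) (Zf : Fin n → VFIdx n)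
    (hZ : ∀ i (g : E n → E n → ℝ) x v, mic t (Zf i) g x v = a * dX i g x v + b * dV i g x v)
    (x v : E n) (l : List (Fin n)) (hl : l.Nodup) :
    ∀ (g : E n → E n → ℝ), Nice g → ∀ y : Fin n → ℝ,
    ‖g (x + a • WithLp.toLp 2 y) (v + b • WithLp.toLp 2 y)‖ₑ ≤
      (∫⋯∫⁻_l.toFinset, (fun y : Fin n → ℝ => ‖micL t (l.reverse.map Zf) g (x + a • WithLp.toLp 2 y)
        (v + b • WithLp.toLp 2 y)‖ₑ) ∂(fun _ => (volume : Measure ℝ))) y := by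
  induction l with
  | nil => intro g hg y; simp [micL]
  | cons i l ih =>
    intro g hg y
    rw [List.nodup_cons] at hl
    have hD : Nice (mic t (Zf i) g) := hg.mic t _
    have hmeas : ∀ k : E n → E n → ℝ, Nice k → Measurable (fun y : Fin n → ℝ =>
        ‖k (x + a • WithLp.toLp 2 y) (v + b • WithLp.toLp 2 y)‖ₑ) := by
      intro k hk
      have : Continuous (fun y : Fin n → ℝ => ((x + a • WithLp.toLp 2 y : E n),
        (v + b • WithLp.toLp 2 y : E n))) := by
        have := PiLp.continuous_toLp 2 (fun _ : Fin n => ℝ)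
        fun_prop
      exact (hk.1.continuous.comp this).enorm.measurable
    rw [List.toFinset_cons, lmarginal_insert _ (hmeas _ (hg.micL t _)) (by simpa using hl.1)]
    set p : E n × E n := (x + a • WithLp.toLp 2 (Function.update y i 0),
      v + b • WithLp.toLp 2 (Function.update y i 0)) with hp
    set w : E n × E n := (a • EuclideanSpace.single i (1 : ℝ), b • EuclideanSpace.single i (1 : ℝ))
      with hw
    have hline : ∀ s : ℝ, ((x + a • WithLp.toLp 2 (Function.update y i s) : E n),
        (v + b • WithLp.toLp 2 (Function.update y i s) : E n)) = p + s • w := by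
      intro s
      rw [toLp_update]
      simp only [hp, hw, Prod.smul_mk, Prod.mk_add_mk, smul_add, smul_comm s, add_assoc]
    have hw0 : w ≠ 0 := by
      intro h0
      have := congrArg (fun q : E n × E n => q.1 i) h0
      simp [hw] at this
      exact hab this
    have hder : ∀ s, deriv (fun s : ℝ => g (p + s • w).1 (p + s • w).2) s =
        mic t (Zf i) g (p + s • w).1 (p + s • w).2 := by
      intro s
      rw [(hg.line_deriv p w s).deriv, hZ, dX_eq hg, dV_eq hg]
      rw [← smul_eq_mul, ← smul_eq_mul, ← map_smul, ← map_smul, ← map_add]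
      have e0 : a • ((EuclideanSpace.single i (1 : ℝ), 0) : E n × E n) +
          b • ((0, EuclideanSpace.single i (1 : ℝ)) : E n × E n) = w := by simp [hw]
      rw [e0]
    have hcd : ContDiff ℝ 1 (fun s : ℝ => g (p + s • w).1 (p + s • w).2) :=
      (hg.1.of_le (by simp)).comp (f := fun s : ℝ => p + s • w) (by fun_prop)
    have key := HasCompactSupport.enorm_le_lintegral_Ici_deriv hcd
      (hg.line_compact p w hw0) (y i)
    have e1 : g (p + (y i) • w).1 (p + (y i) • w).2 =
        g (x + a • WithLp.toLp 2 y) (v + b • WithLp.toLp 2 y) := by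
      rw [← hline]; simp
    simp only [e1] at key
    refine key.trans ((lintegral_mono' Measure.restrict_le_self le_rfl).trans ?_)
    refine lintegral_mono fun s => ?_
    simp only [hder]
    rw [← hline]
    refine (ih hl.2 _ hD (Function.update y i s)).trans (le_of_eq ?_)
    simp [micL]

lemma lintegral_affine (F : E n → ℝ≥0∞) (hF : Measurable F) (x : E n) (a : ℝ) (ha : 0 < a) :
    ∫⁻ y, F (x + a • y) = ENNReal.ofReal ((a ^ n)⁻¹) * ∫⁻ y, F y := by
  have h1 : ∫⁻ y, F (x + y) = ∫⁻ y, F y := lintegral_add_left_eq_self F x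
  have h2 := Measure.map_addHaar_smul (volume : Measure (E n)) ha.ne'
  have h3 : ∫⁻ y, F (x + a • y) = ∫⁻ y, F (x + y) ∂(Measure.map (fun y => a • y) volume) := by
    rw [lintegral_map (by fun_prop) (by fun_prop)]
  rw [h3, h2, lintegral_smul_measure, h1, finrank_euclideanSpace_fin,
    abs_of_pos (by positivity), smul_eq_mul]

lemma sob (t a b : ℝ) (hab : 0 < a) (Zf : Fin n → VFIdx n)
    (hZ : ∀ i (g : E n → E n → ℝ) x v, mic t (Zf i) g x v = a * dX i g x v + b * dV i g x v) :
    ∃ L : List (VFIdx n), L.length = n ∧ ∀ (g : E n → E n → ℝ), Nice g → ∀ x : E n,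
    ∫⁻ v, ‖g x v‖ₑ ≤ ENNReal.ofReal ((a ^ n)⁻¹) * Nrm (micL t L g) := by
  refine ⟨(List.finRange n).reverse.map Zf, by simp, fun g hg x => ?_⟩
  set k := micL t ((List.finRange n).reverse.map Zf) g with hk
  have hkN : Nice k := hg.micL t _
  have h1 : ∀ v : E n, ‖g x v‖ₑ ≤ ∫⁻ y : E n, ‖k (x + a • y) (v + b • y)‖ₑ := by
    intro v
    have := sob_aux t a b hab.ne' Zf hZ x v (List.finRange n) (List.nodup_finRange n) g hg 0
    have hu : (List.finRange n).toFinset = Finset.univ := by ext; simp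
    rw [hu, lmarginal_univ] at this
    simp only [WithLp.toLp_zero, smul_zero, add_zero] at this
    refine this.trans (le_of_eq ?_)
    have hmp := PiLp.volume_preserving_toLp (Fin n)
    rw [← hmp.lintegral_comp]
    · rfl
    · have : Continuous (fun y : E n => ((x + a • y : E n), (v + b • y : E n))) := by fun_prop
      exact (hkN.1.continuous.comp this).enorm.measurable
  calc ∫⁻ v, ‖g x v‖ₑ ≤ ∫⁻ v, ∫⁻ y : E n, ‖k (x + a • y) (v + b • y)‖ₑ := lintegral_mono h1
    _ = ∫⁻ y : E n, ∫⁻ v : E n, ‖k (x + a • y) (v + b • y)‖ₑ := by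
      refine lintegral_lintegral_swap ?_
      have : Continuous (fun q : E n × E n => ((x + a • q.2 : E n), (q.1 + b • q.2 : E n))) := by
        fun_prop
      exact (hkN.1.continuous.comp this).enorm.measurable.aemeasurable
    _ = ∫⁻ y : E n, ∫⁻ v : E n, ‖k (x + a • y) v‖ₑ := by
      refine lintegral_congr fun y => ?_
      exact lintegral_add_right_eq_self (fun v => ‖k (x + a • y) v‖ₑ) (b • y)
    _ = _ := by
      refine lintegral_affine (fun y => ∫⁻ v : E n, ‖k y v‖ₑ) ?_ x a hab
      exact Measurable.lintegral_prod_right' (f := fun p : E n × E n => ‖k p.1 p.2‖ₑ)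
        hkN.1.continuous.enorm.measurable

/-- Klainerman–Sobolev: for `A ≥ 0` bounding all `L¹` norms of order `n` compositions. -/
lemma sob_main (t : ℝ) (ht : 0 ≤ t) (g : E n → E n → ℝ) (hg : Nice g) (A : ℝ)
    (hA : ∀ L : List (VFIdx n), L.length = n → nrm (micL t L g) ≤ A) (x : E n) :
    ∫⁻ v, ‖g x v‖ₑ ≤ ENNReal.ofReal (2 ^ n * A / (1 + t) ^ n) := by
  obtain ⟨L1, hL1, h1⟩ := sob (n := n) t 1 0 one_pos (fun i => Sum.inl i)
    (fun i g x v => by simp [mic_inl])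
  have hA0 : 0 ≤ A := (nrm_nonneg _).trans (hA L1 hL1)
  rcases le_total t 1 with h | h
  · refine (h1 g hg x).trans ?_
    rw [(hg.micL t L1).Nrm_eq, ← ENNReal.ofReal_mul (by positivity)]
    refine ENNReal.ofReal_le_ofReal ?_
    have : (1 + t) ^ n ≤ 2 ^ n := by gcongr; linarith
    rw [le_div_iff₀ (by positivity)]
    simp only [one_pow, inv_one, one_mul]
    calc _ ≤ A * 2 ^ n := by gcongr; exact hA L1 hL1
      _ = _ := mul_comm _ _
  · have ht0 : 0 < t := by linarith
    obtain ⟨L2, hL2, h2⟩ := sob (n := n) t t 1 ht0 (fun i => Sum.inr (Sum.inl i))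
      (fun i g x v => by simp [mic_inr_inl])
    refine (h2 g hg x).trans ?_
    rw [(hg.micL t L2).Nrm_eq, ← ENNReal.ofReal_mul (by positivity)]
    refine ENNReal.ofReal_le_ofReal ?_
    have : (1 + t) ^ n ≤ 2 ^ n * t ^ n := by rw [← mul_pow]; gcongr; linarith
    rw [le_div_iff₀ (by positivity)]
    calc _ ≤ (t ^ n)⁻¹ * A * (2 ^ n * t ^ n) := by gcongr; exact hA L2 hL2
      _ = _ := by field_simp

open scoped ENNReal
open Filter Topology

def C1c (h : E n → ℝ) : Prop := ContDiff ℝ 1 h ∧ HasCompactSupport h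

lemma C1c.pd_cont {h : E n → ℝ} (hh : C1c h) (i : Fin n) : Continuous (pd i h) :=
  (hh.1.continuous_fderiv one_ne_zero).clm_apply continuous_const

lemma C1c.pd_supp {h : E n → ℝ} (hh : C1c h) (i : Fin n) : HasCompactSupport (pd i h) :=
  hh.2.fderiv_apply (𝕜 := ℝ) _

lemma coord_cd (i : Fin n) : ContDiff ℝ 1 (fun z : E n => z i) :=
  (EuclideanSpace.proj (𝕜 := ℝ) i).contDiff

lemma coord_cont (i : Fin n) : Continuous (fun z : E n => z i) := (coord_cd i).continuous

lemma C1c.cmul {h : E n → ℝ} (hh : C1c h) (i : Fin n) : C1c (fun z => z i * h z) :=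
  ⟨(coord_cd i).mul hh.1, hh.2.mul_left⟩

lemma C1c.pd_cmul {h : E n → ℝ} (hh : C1c h) (i j : Fin n) (z : E n) :
    pd j (fun z => z i * h z) z = (if i = j then 1 else 0) * h z + z i * pd j h z := by
  have h1 : HasFDerivAt (fun z : E n => z i) (EuclideanSpace.proj (𝕜 := ℝ) i) z :=
    (EuclideanSpace.proj (𝕜 := ℝ) i).hasFDerivAt
  have h2 := (hh.1.differentiable one_ne_zero z).hasFDerivAt
  unfold pd
  rw [show (fun z : E n => z i * h z) = (fun z : E n => z i) * h from rfl, (h1.mul h2).fderiv]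
  simp
  ring

lemma C1c.refl {h : E n → ℝ} (hh : C1c h) (x : E n) : C1c (fun z => h (x - z)) :=
  ⟨hh.1.comp (f := fun z => x - z) (by fun_prop),
    hh.2.comp_isClosedEmbedding (g := fun z => x - z) (Homeomorph.subLeft x).isClosedEmbedding⟩

lemma C1c.pd_refl {h : E n → ℝ} (hh : C1c h) (x : E n) (i : Fin n) (z : E n) :
    pd i (fun z => h (x - z)) z = - pd i h (x - z) := by
  unfold pd
  have h1 : HasFDerivAt (fun z : E n => x - z) (-ContinuousLinearMap.id ℝ (E n)) z :=
    (hasFDerivAt_id z).const_sub x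
  have h2 := (hh.1.differentiable one_ne_zero (x - z)).hasFDerivAt
  rw [show (fun z : E n => h (x - z)) = h ∘ (fun z => x - z) from rfl, (h2.comp z h1).fderiv]
  simp

lemma abs_coord_le (z : E n) (i : Fin n) : |z i| ≤ ‖z‖ := by
  simpa using PiLp.norm_apply_le z i

lemma locInt (hn : 3 ≤ n) (s : ℝ) (hs : -(n : ℝ) < s) :
    LocallyIntegrable (fun z : E n => ‖z‖ ^ s) := by
  refine locallyIntegrable_of_norm_le_rpow (C := 1) (α := -s) (by simp; omega) (by simp; linarith)
    (Eventually.of_forall fun z => ?_) ?_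
  · rw [Real.norm_of_nonneg (by positivity)]; simp
  · exact (measurable_norm.pow_const s).aestronglyMeasurable

lemma kint (hn : 3 ≤ n) (s : ℝ) (hs : -(n : ℝ) < s) {h : E n → ℝ} (h1 : Continuous h)
    (h2 : HasCompactSupport h) : Integrable (fun z => ‖z‖ ^ s * h z) :=
  (locInt hn s hs).integrable_smul_right_of_hasCompactSupport h1 h2

lemma ae_ne_zero (hn : 3 ≤ n) : ∀ᵐ z : E n, z ≠ 0 := by
  have : Nonempty (Fin n) := ⟨⟨0, by omega⟩⟩
  exact (measure_singleton (0 : E n) : volume {(0 : E n)} = 0) |> compl_mem_ae_iff.2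

lemma limδ (hn : 3 ≤ n) (q : ℝ) (hq : q ≤ 0) (w : E n → ℝ) (hw : Continuous w)
    (hInteg : Integrable (fun z => ‖z‖ ^ q * w z)) :
    Tendsto (fun δ : ℝ => ∫ z : E n, (‖z‖ ^ 2 + δ) ^ (q / 2) * w z) (𝓝[>] 0)
      (𝓝 (∫ z : E n, ‖z‖ ^ q * w z)) := by
  refine tendsto_integral_filter_of_dominated_convergence (fun z => ‖‖z‖ ^ q * w z‖) ?_ ?_
    hInteg.norm ?_
  · filter_upwards [self_mem_nhdsWithin] with δ (hδ : 0 < δ)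
    refine Continuous.aestronglyMeasurable (Continuous.mul ?_ hw)
    exact Continuous.rpow_const (by fun_prop) fun z => Or.inl (by positivity)
  · filter_upwards [self_mem_nhdsWithin] with δ (hδ : 0 < δ)
    filter_upwards [ae_ne_zero hn] with z hz
    have hz' : 0 < ‖z‖ := norm_pos_iff.2 hz
    rw [norm_mul, norm_mul]
    refine mul_le_mul_of_nonneg_right ?_ (norm_nonneg _)
    rw [Real.norm_of_nonneg (by positivity), Real.norm_of_nonneg (by positivity)]
    calc (‖z‖ ^ 2 + δ) ^ (q / 2) ≤ (‖z‖ ^ 2) ^ (q / 2) :=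
          Real.rpow_le_rpow_of_nonpos (by positivity) (by linarith) (by linarith)
      _ = ‖z‖ ^ q := by
          rw [← Real.rpow_natCast, ← Real.rpow_mul hz'.le]; congr 1; push_cast; ring
  · filter_upwards [ae_ne_zero hn] with z hz
    have hz' : 0 < ‖z‖ := norm_pos_iff.2 hz
    refine Tendsto.mul_const _ ?_
    have e : ‖z‖ ^ q = (‖z‖ ^ 2 + 0) ^ (q / 2) := by
      rw [add_zero, ← Real.rpow_natCast, ← Real.rpow_mul hz'.le]; congr 1; push_cast; ring
    rw [e]
    refine Tendsto.mono_left ?_ nhdsWithin_le_nhds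
    refine ContinuousAt.tendsto (f := fun δ : ℝ => (‖z‖ ^ 2 + δ) ^ (q / 2)) ?_
    exact ContinuousAt.rpow_const (by fun_prop) (Or.inl (by positivity))

lemma int_k1 (hn : 3 ≤ n) {u : E n → ℝ} (h1 : Continuous u) (h2 : HasCompactSupport u)
    (j : Fin n) : Integrable (fun z : E n => ‖z‖ ^ (-(n : ℝ)) * (z j * u z)) := by
  refine (kint hn (1 - (n : ℝ)) (by linarith) h1 h2).mono ?_ ?_
  · have : Measurable (fun z : E n => ‖z‖ ^ (-(n : ℝ))) := measurable_norm.pow_const _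
    exact (this.mul ((coord_cont j).mul h1).measurable).aestronglyMeasurable
  · filter_upwards [ae_ne_zero hn] with z hz
    have hz' : 0 < ‖z‖ := norm_pos_iff.2 hz
    simp only [norm_mul]
    rw [Real.norm_of_nonneg (by positivity), Real.norm_of_nonneg (r := ‖z‖ ^ _) (by positivity),
      ← mul_assoc]
    refine mul_le_mul_of_nonneg_right ?_ (norm_nonneg _)
    rw [sub_eq_add_neg, add_comm, Real.rpow_add hz', Real.rpow_one]
    gcongr
    exact abs_coord_le z j

lemma ibpK (hn : 3 ≤ n) {u : E n → ℝ} (hu : C1c u) (j : Fin n) :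
    ∫ z : E n, ‖z‖ ^ ((2 : ℝ) - n) * pd j u z =
      ((n : ℝ) - 2) * ∫ z : E n, ‖z‖ ^ (-(n : ℝ)) * (z j * u z) := by
  have hn' : (3 : ℝ) ≤ n := by exact_mod_cast hn
  have l1 := limδ hn ((2 : ℝ) - n) (by linarith) (pd j u) (hu.pd_cont j)
    (kint hn _ (by linarith) (hu.pd_cont j) (hu.pd_supp j))
  have l2 := (limδ hn (-(n : ℝ)) (by linarith) (fun z => z j * u z)
    ((coord_cont j).mul hu.1.continuous) (int_k1 hn hu.1.continuous hu.2 j)).const_mul ((n : ℝ) - 2)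
  refine tendsto_nhds_unique l1 (l2.congr' ?_)
  filter_upwards [self_mem_nhdsWithin] with δ (hδ : 0 < δ)
  have hder : ∀ z : E n, HasFDerivAt (fun z : E n => (‖z‖ ^ 2 + δ) ^ (((2 : ℝ) - n) / 2))
      ((((2 : ℝ) - n) / 2 * (‖z‖ ^ 2 + δ) ^ (((2 : ℝ) - n) / 2 - 1)) •
        ((2 : ℕ) • (innerSL ℝ z).comp (ContinuousLinearMap.id ℝ (E n)))) z := by
    intro z
    exact (((hasFDerivAt_id z).norm_sq).add_const δ).rpow_const (Or.inl (by positivity))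
  have hval : ∀ z : E n, fderiv ℝ (fun z : E n => (‖z‖ ^ 2 + δ) ^ (((2 : ℝ) - n) / 2)) z
      (EuclideanSpace.single j 1) = -((n : ℝ) - 2) * ((‖z‖ ^ 2 + δ) ^ (-(n : ℝ) / 2) * z j) := by
    intro z
    rw [(hder z).fderiv]
    have : ((2 : ℝ) - n) / 2 - 1 = -(n : ℝ) / 2 := by ring
    rw [this]
    simp [EuclideanSpace.inner_single_right]
    ring
  have hc1 : ∀ q : ℝ, Continuous (fun z : E n => (‖z‖ ^ 2 + δ) ^ q) := fun q =>
    Continuous.rpow_const (by fun_prop) fun z => Or.inl (by positivity)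
  have key := integral_mul_fderiv_eq_neg_fderiv_mul_of_integrable (μ := (volume : Measure (E n)))
    (f := fun z : E n => (‖z‖ ^ 2 + δ) ^ (((2 : ℝ) - n) / 2)) (g := u)
    (v := EuclideanSpace.single j 1) ?_ ?_ ?_ (fun z _ => (hder z).differentiableAt)
    (fun z _ => hu.1.differentiable one_ne_zero z)
  · change _ = ∫ z : E n, (‖z‖ ^ 2 + δ) ^ (((2 : ℝ) - n) / 2) *
      fderiv ℝ u z (EuclideanSpace.single j 1)
    rw [key, ← integral_const_mul, ← integral_neg]
    refine integral_congr_ae (Eventually.of_forall fun z => ?_)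
    simp only [hval]
    ring
  · simp only [hval]
    refine Continuous.integrable_of_hasCompactSupport ?_ hu.2.mul_left
    exact (continuous_const.mul ((hc1 _).mul (coord_cont j))).mul hu.1.continuous
  · exact Continuous.integrable_of_hasCompactSupport ((hc1 _).mul (hu.pd_cont j))
      (hu.pd_supp j).mul_left
  · exact Continuous.integrable_of_hasCompactSupport ((hc1 _).mul hu.1.continuous) hu.2.mul_left

/-- Newtonian-type potential. -/
def Pot (h : E n → ℝ) (x : E n) : ℝ := ∫ z : E n, ‖z‖ ^ ((2 : ℝ) - n) * h (x - z)

lemma Pot_eq (h : E n → ℝ) (x : E n) :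
    ∫ y : E n, ‖x - y‖ ^ ((2 : ℝ) - n) * h y = Pot h x := by
  unfold Pot
  rw [← integral_sub_left_eq_self (fun z => ‖z‖ ^ ((2 : ℝ) - n) * h (x - z)) volume x]
  simp

lemma Pot_int (hn : 3 ≤ n) {h : E n → ℝ} (h1 : Continuous h) (h2 : HasCompactSupport h)
    (x : E n) : Integrable (fun z : E n => ‖z‖ ^ ((2 : ℝ) - n) * h (x - z)) :=
  kint hn _ (by linarith) (h1.comp (by fun_prop : Continuous fun z => x - z))
    (h2.comp_isClosedEmbedding (g := fun z => x - z) (Homeomorph.subLeft x).isClosedEmbedding)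

lemma pd_Pot (hn : 3 ≤ n) {h : E n → ℝ} (hh : C1c h) (i : Fin n) (x : E n) :
    pd i (Pot h) x = Pot (pd i h) x := by
  have := hh.2.hasFDerivAt_convolution_right (ContinuousLinearMap.mul ℝ ℝ)
    (locInt hn ((2 : ℝ) - n) (by linarith)) hh.1 x
  have e : Pot h = (convolution (fun z : E n => ‖z‖ ^ ((2 : ℝ) - n)) h
    (ContinuousLinearMap.mul ℝ ℝ) volume) := rfl
  unfold pd
  rw [e, this.fderiv, convolution_precompR_apply _ (locInt hn ((2 : ℝ) - n) (by linarith))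
    (hh.2.fderiv (𝕜 := ℝ)) (hh.1.continuous_fderiv one_ne_zero)]
  rfl

/-- `xᵢ ∂ⱼ` against the potential. -/
lemma coord_pd_Pot (hn : 3 ≤ n) {h : E n → ℝ} (hh : C1c h) (i j : Fin n) (x : E n) :
    x i * pd j (Pot h) x = Pot (fun y => y i * pd j h y) x + (if i = j then 1 else 0) * Pot h x
      - ((n : ℝ) - 2) * ∫ z : E n, ‖z‖ ^ (-(n : ℝ)) * (z j * (z i * h (x - z))) := by
  rw [pd_Pot hn hh]
  have hr := hh.refl x
  rw [← ibpK hn (hr.cmul i) j]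
  have hi1 : Integrable (fun z : E n => ‖z‖ ^ ((2 : ℝ) - n) * ((x - z) i * pd j h (x - z))) :=
    Pot_int hn (h := fun y => y i * pd j h y) ((coord_cont i).mul (hh.pd_cont j))
    ((hh.pd_supp j).mul_left) x
  have hi2 := (Pot_int hn hh.1.continuous hh.2 x).const_mul (if i = j then (1 : ℝ) else 0)
  have hi3 := kint hn ((2 : ℝ) - n) (by linarith) ((hr.cmul i).pd_cont j) ((hr.cmul i).pd_supp j)
  unfold Pot
  rw [← integral_const_mul, ← integral_const_mul, ← integral_add hi1 hi2, ← integral_sub _ hi3]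
  · refine integral_congr_ae (Eventually.of_forall fun z => ?_)
    simp only [hr.pd_cmul, hh.pd_refl, PiLp.sub_apply]
    ring
  · exact hi1.add hi2

lemma pd_Pot_bound (hn : 3 ≤ n) {h : E n → ℝ} (hh : C1c h) (j : Fin n) (x : E n) :
    |pd j (Pot h) x| ≤ ((n : ℝ) - 2) * ∫ z : E n, ‖z‖ ^ ((1 : ℝ) - n) * |h (x - z)| := by
  have hn' : (3 : ℝ) ≤ n := by exact_mod_cast hn
  have hr := hh.refl x
  have e : pd j (Pot h) x = -∫ z : E n, ‖z‖ ^ ((2 : ℝ) - n) * pd j (fun z => h (x - z)) z := by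
    rw [pd_Pot hn hh, ← integral_neg]
    refine integral_congr_ae (Eventually.of_forall fun z => ?_)
    simp only [hh.pd_refl]; ring
  rw [e, ibpK hn hr, abs_neg, abs_mul, abs_of_nonneg (by linarith)]
  refine mul_le_mul_of_nonneg_left ?_ (by linarith)
  rw [← Real.norm_eq_abs]
  refine norm_integral_le_of_norm_le
    (kint hn _ (by linarith) hr.1.continuous.abs (hr.2.comp_left abs_zero)) ?_
  filter_upwards [ae_ne_zero hn] with z hz
  have hz' : 0 < ‖z‖ := norm_pos_iff.2 hz
  simp only [norm_mul]
  rw [Real.norm_of_nonneg (by positivity), ← mul_assoc,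
    show (1 : ℝ) - n = -(n : ℝ) + 1 by ring, Real.rpow_add hz', Real.rpow_one]
  gcongr
  · exact abs_coord_le z j
  · exact le_rfl

open scoped ENNReal
open Filter Topology

def rh (g : E n → E n → ℝ) (x : E n) : ℝ := ∫ v : E n, g x v

lemma Nice.supp_v {g : E n → E n → ℝ} (h : Nice g) :
    ∃ k : Set (E n), IsCompact k ∧ ∀ x v, v ∉ k → g x v = 0 := by
  refine ⟨Prod.snd '' tsupport (fun p : E n × E n => g p.1 p.2), h.2.isCompact.image continuous_snd,
    fun x v hv => ?_⟩
  by_contra hne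
  exact hv ⟨(x, v), subset_tsupport _ (by simpa using hne), rfl⟩

lemma Nice.supp_x {g : E n → E n → ℝ} (h : Nice g) :
    ∃ k : Set (E n), IsCompact k ∧ ∀ x v, x ∉ k → g x v = 0 := by
  refine ⟨Prod.fst '' tsupport (fun p : E n × E n => g p.1 p.2), h.2.isCompact.image continuous_fst,
    fun x v hv => ?_⟩
  by_contra hne
  exact hv ⟨(x, v), subset_tsupport _ (by simpa using hne), rfl⟩

lemma Nice.bound {g : E n → E n → ℝ} (h : Nice g) :
    ∃ b : E n → ℝ, Integrable b ∧ ∀ x v, ‖g x v‖ ≤ b v := by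
  obtain ⟨k, hk, hz⟩ := h.supp_v
  obtain ⟨C, hC⟩ := h.2.exists_bound_of_continuous h.1.continuous
  refine ⟨k.indicator (fun _ => C), ?_, fun x v => ?_⟩
  · rw [integrable_indicator_iff hk.measurableSet]
    exact integrableOn_const hk.measure_lt_top.ne
  · by_cases hv : v ∈ k
    · simpa [hv] using hC (x, v)
    · simp [hv, hz x v hv]

lemma Nice.int_v {g : E n → E n → ℝ} (h : Nice g) (x : E n) : Integrable (fun v => g x v) :=
  (h.slice x).1.continuous.integrable_of_hasCompactSupport (h.slice x).2

lemma Nice.rh_C1c {g : E n → E n → ℝ} (h : Nice g) : C1c (rh g) := by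
  obtain ⟨k, hk, hz⟩ := h.supp_v
  obtain ⟨k', hk', hz'⟩ := h.supp_x
  constructor
  · have := contDiffOn_convolution_right_with_param (𝕜 := ℝ) (μ := (volume : Measure (E n)))
      (f := fun _ : E n => (1 : ℝ)) (n := 1)
      (ContinuousLinearMap.mul ℝ ℝ) (g := g) (s := Set.univ) (k := k) isOpen_univ hk
      (fun p x _ hx => hz p x hx) (locallyIntegrable_const 1)
      ((h.1.of_le (by simp)).contDiffOn)
    rw [Set.univ_prod_univ, contDiffOn_univ] at this
    have h2 := this.comp (f := fun x : E n => (x, (0 : E n))) (by fun_prop)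
    convert! h2 using 1
    funext x
    simp only [rh, Function.comp, convolution_def, ContinuousLinearMap.mul_apply', one_mul]
    rw [integral_sub_left_eq_self (fun v => g x v) volume 0]
  · refine HasCompactSupport.of_support_subset_isCompact hk' fun x hx => ?_
    by_contra hne
    exact hx (by simp [rh, hz' x _ hne])

lemma Nice.pd_rh {g : E n → E n → ℝ} (h : Nice g) (i : Fin n) (x : E n) :
    pd i (rh g) x = rh (_root_.dX i g) x := by
  set e : E n := EuclideanSpace.single i 1 with he
  have hline : ∀ s : ℝ, HasDerivAt (fun s : ℝ => x + s • e) e s := fun s => by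
    simpa using ((hasDerivAt_id s).smul_const e).const_add x
  have h1 : HasDerivAt (fun s : ℝ => rh g (x + s • e)) (pd i (rh g) x) 0 := by
    have hd : HasFDerivAt (rh g) (fderiv ℝ (rh g) x) (x + (0 : ℝ) • e) := by
      simpa using (h.rh_C1c.1.differentiable one_ne_zero x).hasFDerivAt
    exact hd.comp_hasDerivAt 0 (hline 0)
  obtain ⟨b, hb, hbb⟩ := (h.dX i).bound
  have h2 := (hasDerivAt_integral_of_dominated_loc_of_deriv_le (μ := (volume : Measure (E n)))
    (F := fun (s : ℝ) v => g (x + s • e) v) (F' := fun (s : ℝ) v => _root_.dX i g (x + s • e) v)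
    (x₀ := (0 : ℝ)) (s := Set.univ) (bound := b) univ_mem
    (Eventually.of_forall fun s => (h.int_v _).aestronglyMeasurable) (h.int_v _)
    ((h.dX i).int_v _).aestronglyMeasurable
    (Eventually.of_forall fun v s _ => hbb _ _) hb
    (Eventually.of_forall fun v s _ => ?_)).2
  · have := h1.unique h2
    simpa [rh] using this
  · exact (h.diff_x v (x + s • e)).hasFDerivAt.comp_hasDerivAt s (hline s)

lemma Nice.slice_C1c {g : E n → E n → ℝ} (h : Nice g) (x : E n) : C1c (fun v => g x v) :=
  ⟨(h.slice x).1.of_le (by simp), (h.slice x).2⟩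

lemma int_pd_zero {u : E n → ℝ} (hu : C1c u) (j : Fin n) : ∫ v, pd j u v = 0 := by
  have := integral_mul_fderiv_eq_neg_fderiv_mul_of_integrable (μ := (volume : Measure (E n)))
    (f := fun _ => (1 : ℝ)) (g := u) (v := EuclideanSpace.single j 1) (by simp) ?_ ?_ (by simp)
    (fun z _ => hu.1.differentiable one_ne_zero z)
  · simpa [pd] using this
  · simp only [one_mul]
    exact (hu.pd_cont j).integrable_of_hasCompactSupport (hu.pd_supp j)
  · simpa using hu.1.continuous.integrable_of_hasCompactSupport hu.2

lemma Nice.rh_dV {g : E n → E n → ℝ} (h : Nice g) (i : Fin n) (x : E n) : rh (_root_.dV i g) x = 0 :=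
  int_pd_zero (h.slice_C1c x) i

lemma Nice.rh_vdV {g : E n → E n → ℝ} (h : Nice g) (i j : Fin n) (x : E n) :
    rh (fun x v => v i * _root_.dV j g x v) x = - ((if i = j then 1 else 0) * rh g x) := by
  have h1 := int_pd_zero ((h.slice_C1c x).cmul i) j
  simp only [(h.slice_C1c x).pd_cmul] at h1
  change ∫ v, (if i = j then (1 : ℝ) else 0) * g x v + v i * _root_.dV j g x v = 0 at h1
  rw [integral_add ((h.int_v x).const_mul _) (((h.dV j).vmul i).int_v x), integral_const_mul] at h1
  unfold rh
  change ∫ v, v i * _root_.dV j g x v = _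
  linarith

lemma rh_add {g k : E n → E n → ℝ} (h : Nice g) (h' : Nice k) (x : E n) :
    rh (fun x v => g x v + k x v) x = rh g x + rh k x := integral_add (h.int_v x) (h'.int_v x)

lemma rh_sub {g k : E n → E n → ℝ} (h : Nice g) (h' : Nice k) (x : E n) :
    rh (fun x v => g x v - k x v) x = rh g x - rh k x := integral_sub (h.int_v x) (h'.int_v x)

lemma rh_cmul (g : E n → E n → ℝ) (c : ℝ) (x : E n) :
    rh (fun x v => c * g x v) x = c * rh g x := integral_const_mul _ _

lemma rh_xmul (g : E n → E n → ℝ) (i : Fin n) (x : E n) :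
    rh (fun x v => x i * g x v) x = x i * rh g x := integral_const_mul _ _

lemma rh_sum (g : Fin n → E n → E n → ℝ) (h : ∀ i, Nice (g i)) (x : E n) :
    rh (fun x v => ∑ i, g i x v) x = ∑ i, rh (g i) x :=
  integral_finsetSum _ fun i _ => (h i).int_v x

lemma Pot_add (hn : 3 ≤ n) {h k : E n → ℝ} (h1 : C1c h) (k1 : C1c k) (x : E n) (c d : ℝ) :
    Pot (fun x => c * h x + d * k x) x = c * Pot h x + d * Pot k x := by
  have a1 := (Pot_int hn h1.1.continuous h1.2 x).const_mul c
  have a2 := (Pot_int hn k1.1.continuous k1.2 x).const_mul d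
  unfold Pot
  rw [← integral_const_mul, ← integral_const_mul, ← integral_add a1 a2]
  congr 1; funext z; ring

lemma Pot_sum (hn : 3 ≤ n) (h : Fin n → E n → ℝ) (hc : ∀ i, Continuous (h i))
    (hs : ∀ i, HasCompactSupport (h i)) (x : E n) :
    Pot (fun x => ∑ i, h i x) x = ∑ i, Pot (h i) x := by
  unfold Pot
  rw [← integral_finsetSum _ fun i _ => Pot_int hn (hc i) (hs i) x]
  congr 1; funext z; rw [Finset.mul_sum]

/-- macro field at fixed time -/
def mac (t : ℝ) (Z : VFIdx n) (φ : E n → ℝ) : E n → ℝ :=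
  fun x => macroApply Z (fun _ => φ) t x

lemma macroApply_eq (t : ℝ) (Z : VFIdx n) (F : ℝ → E n → ℝ) :
    macroApply Z F t = mac t Z (F t) := by
  funext x
  rcases Z with i | i | i | i <;> rfl

lemma pd_const_mul (c : ℝ) (φ : E n → ℝ) (i : Fin n) (x : E n) :
    pd i (fun y => c * φ y) x = c * pd i φ x := by
  unfold pd
  have : (fun y => c * φ y) = c • φ := rfl
  rw [this, fderiv_const_smul_field]
  simp

lemma mac_const_mul (t c : ℝ) (φ : E n → ℝ) (Z : VFIdx n) :
    mac t Z (fun y => c * φ y) = fun x => c * mac t Z φ x := by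
  funext x
  rcases Z with i | i | p | u <;> simp only [mac, macroApply, pd_const_mul]
  · ring
  · ring
  · rw [Finset.mul_sum]; congr 1; funext i; ring

lemma mac_Pot (hn : 3 ≤ n) (t : ℝ) (Z : VFIdx n) {g : E n → E n → ℝ} (hg : Nice g) :
    mac t Z (Pot (rh g)) = Pot (rh (fun x v => mic t Z g x v + cZ Z * g x v)) := by
  have hr := hg.rh_C1c
  have hX : ∀ i, pd i (rh g) = rh (dX i g) := fun i => funext fun x => hg.pd_rh i x
  have hsplit : rh (fun x v => mic t Z g x v + cZ Z * g x v) =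
      fun x => 1 * rh (mic t Z g) x + cZ Z * rh g x := by
    funext x
    rw [rh_add (hg.mic t Z) (hg.cmul _), rh_cmul, one_mul]
  funext x
  rw [hsplit, Pot_add hn (hg.mic t Z).rh_C1c hr, one_mul]
  rcases Z with i | i | p | u
  · have : rh (mic t (Sum.inl i) g) = rh (dX i g) := rfl
    rw [this]
    simp only [mac, macroApply, cZ, pd_Pot hn hr, hX]; ring
  · have : rh (mic t (Sum.inr (Sum.inl i)) g) = fun x => t * rh (dX i g) x + 0 * rh g x := by
      funext x
      have := rh_add ((hg.dX i).cmul t) (hg.dV i) x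
      rw [rh_cmul, hg.rh_dV] at this
      rw [zero_mul]; exact this
    rw [this, Pot_add hn (hg.dX i).rh_C1c hr]
    simp only [mac, macroApply, cZ, pd_Pot hn hr, hX]; ring
  · obtain ⟨⟨i, j⟩, hij⟩ := p
    have hij' : i ≠ j := ne_of_lt hij
    have : rh (mic t (Sum.inr (Sum.inr (Sum.inl ⟨(i, j), hij⟩))) g) =
        fun x => 1 * (x i * rh (dX j g) x) + (-1) * (x j * rh (dX i g) x) := by
      funext x
      have := rh_sub ((((hg.dX j).xmul i).sub ((hg.dX i).xmul j)).add ((hg.dV j).vmul i))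
        ((hg.dV i).vmul j) x
      rw [rh_add (((hg.dX j).xmul i).sub ((hg.dX i).xmul j)) ((hg.dV j).vmul i),
        rh_sub ((hg.dX j).xmul i) ((hg.dX i).xmul j), rh_xmul, rh_xmul, hg.rh_vdV, hg.rh_vdV] at this
      simp only [hij', hij'.symm, if_false] at this
      refine Eq.trans this ?_
      ring
    rw [this, Pot_add hn ((hg.dX j).rh_C1c.cmul i) ((hg.dX i).rh_C1c.cmul j)]
    have e1 := coord_pd_Pot hn hr i j x
    have e2 := coord_pd_Pot hn hr j i x
    rw [hX] at e1 e2
    simp only [hij', hij'.symm, if_false] at e1 e2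
    have e3 : ∫ z : E n, ‖z‖ ^ (-(n : ℝ)) * (z j * (z i * rh g (x - z))) =
        ∫ z : E n, ‖z‖ ^ (-(n : ℝ)) * (z i * (z j * rh g (x - z))) := by
      congr 1; funext z; ring
    rw [e3] at e1
    simp only [mac, macroApply, cZ]
    rw [e1, e2]; ring
  · have : rh (mic t (Sum.inr (Sum.inr (Sum.inr u))) g) =
        fun x => 1 * (∑ i, x i * rh (dX i g) x) + (-(n : ℝ)) * rh g x := by
      funext x
      have := rh_add (nice_sum Finset.univ _ fun i _ => (hg.dX i).xmul i)
        (nice_sum Finset.univ _ fun i _ => (hg.dV i).vmul i) x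
      rw [rh_sum _ (fun i => (hg.dX i).xmul i), rh_sum _ (fun i => (hg.dV i).vmul i)] at this
      simp only [rh_xmul, hg.rh_vdV] at this
      refine Eq.trans this ?_
      simp
    have hc : ∀ i, C1c (fun x : E n => x i * rh (dX i g) x) := fun i => (hg.dX i).rh_C1c.cmul i
    have hsum : C1c (fun x : E n => ∑ i, x i * rh (dX i g) x) := by
      have := (nice_sum Finset.univ _ fun i _ => (hg.dX i).xmul i).rh_C1c
      have e : rh (fun x v => ∑ i, x i * dX i g x v) = fun x : E n => ∑ i, x i * rh (dX i g) x := by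
        funext x
        rw [rh_sum _ (fun i => (hg.dX i).xmul i)]
        simp only [rh_xmul]
      rwa [e] at this
    rw [this, Pot_add hn hsum hr, Pot_sum hn _ (fun i => (hc i).1.continuous) (fun i => (hc i).2)]
    have e1 := fun i => coord_pd_Pot hn hr i i x
    simp only [mac, macroApply, cZ]
    simp only [e1, hX, if_true, one_mul]
    rw [Finset.sum_sub_distrib, Finset.sum_add_distrib, ← Finset.mul_sum]
    have e2 : ∑ i : Fin n, ∫ z : E n, ‖z‖ ^ (-(n : ℝ)) * (z i * (z i * rh g (x - z))) =
        Pot (rh g) x := by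
      rw [← integral_finsetSum]
      · unfold Pot
        refine integral_congr_ae ?_
        filter_upwards [ae_ne_zero hn] with z hz
        have hz' : 0 < ‖z‖ := norm_pos_iff.2 hz
        have hs : ‖z‖ ^ 2 = ∑ i, z i * z i := by
          rw [EuclideanSpace.norm_sq_eq]; simp [sq]
        rw [← Finset.mul_sum]
        have : ∑ i, z i * (z i * rh g (x - z)) = ‖z‖ ^ 2 * rh g (x - z) := by
          rw [hs, Finset.sum_mul]; congr 1; funext i; ring
        rw [this, show (2 : ℝ) - n = -(n : ℝ) + (2 : ℕ) by push_cast; ring, Real.rpow_add hz',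
          Real.rpow_natCast]
        ring
      · intro i _
        exact int_k1 hn ((hr.refl x).cmul i).1.continuous ((hr.refl x).cmul i).2 i
    rw [e2]
    simp
    ring

lemma macroList_Pot (hn : 3 ≤ n) (t c : ℝ) (L : List (VFIdx n)) {g : E n → E n → ℝ} (hg : Nice g)
    (F : ℝ → E n → ℝ) (hF : F t = fun x => c * Pot (rh g) x) :
    macroList L F t = fun x => c * Pot (rh (gL t L g)) x := by
  induction L with
  | nil => exact hF
  | cons Z L ih =>
    change macroApply Z (macroList L F) t = _
    rw [macroApply_eq, ih, mac_const_mul, mac_Pot hn t Z (hg.gL t L)]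
    rfl

open scoped ENNReal
open Filter Topology

lemma Nice.nrm_eq_prod {g : E n → E n → ℝ} (h : Nice g) :
    nrm g = ∫ p : E n × E n, |g p.1 p.2| := by
  rw [Measure.volume_eq_prod, integral_prod _ (by
      rw [← Measure.volume_eq_prod]; exact h.integrable.abs)]
  rfl

lemma nrm_lin {g k : E n → E n → ℝ} (h : Nice g) (h' : Nice k) (c : ℝ) :
    nrm (fun x v => g x v + c * k x v) ≤ nrm g + |c| * nrm k := by
  rw [(h.add (h'.cmul c)).nrm_eq_prod, h.nrm_eq_prod, h'.nrm_eq_prod, ← integral_const_mul,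
    ← integral_add h.integrable.abs (h'.integrable.abs.const_mul _)]
  refine integral_mono (h.add (h'.cmul c)).integrable.abs
    (h.integrable.abs.add (h'.integrable.abs.const_mul _)) fun p => ?_
  refine (abs_add_le _ _).trans ?_
  rw [abs_mul]

lemma abs_cZ_le (Z : VFIdx n) : |cZ Z| ≤ (n : ℝ) + 2 := by
  rcases Z with i | i | p | u <;> simp only [cZ, abs_zero]
  · positivity
  · positivity
  · positivity
  · rw [abs_of_nonneg (by positivity)]

lemma gL_bound {f : E n → E n → ℝ} (hf : Nice f) (t : ℝ) (N : ℕ) (A : ℝ)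
    (hA : ∀ K : List (VFIdx n), K.length ≤ N → nrm (micL t K f) ≤ A) (L : List (VFIdx n)) :
    ∀ K : List (VFIdx n), K.length + L.length ≤ N →
      nrm (micL t K (gL t L f)) ≤ ((n : ℝ) + 3) ^ L.length * A := by
  induction L with
  | nil => intro K hK; simpa [gL] using hA K (by simpa using hK)
  | cons Z L ih =>
    intro K hK
    have hg := hf.gL t L
    simp only [List.length_cons] at hK
    change nrm (micL t K (fun x v => mic t Z (gL t L f) x v + cZ Z * gL t L f x v)) ≤ _
    rw [micL_lin (hg.mic t Z) hg]
    refine (nrm_lin ((hg.mic t Z).micL t K) (hg.micL t K) _).trans ?_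
    have h1 := ih (K ++ [Z]) (by simp; omega)
    have h2 := ih K (by omega)
    rw [micL_append] at h1
    change nrm (micL t K (mic t Z (gL t L f))) ≤ _ at h1
    have h3 := mul_le_mul (abs_cZ_le Z) h2 (nrm_nonneg _) (by positivity)
    rw [List.length_cons, pow_succ]
    linarith

def kap (z : E n) : ℝ≥0∞ := ENNReal.ofReal (‖z‖ ^ ((1 : ℝ) - n))

lemma kap_meas : Measurable (kap (n := n)) :=
  ENNReal.measurable_ofReal.comp (measurable_norm.pow_const _)

lemma kap_ball (hn : 3 ≤ n) : ∃ c : ℝ, 0 ≤ c ∧ ∀ R : ℝ, 0 < R →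
    ∫⁻ z in Metric.ball (0 : E n) R, kap z ≤ ENNReal.ofReal (c * R) := by
  have : Nonempty (Fin n) := ⟨⟨0, by omega⟩⟩
  refine ⟨n * volume.real (Metric.ball (0 : E n) 1), by positivity, fun R hR => le_of_eq ?_⟩
  have hi : IntegrableOn (fun z : E n => ‖z‖ ^ ((1 : ℝ) - n)) (Metric.ball 0 R) :=
    ((locInt hn ((1 : ℝ) - n) (by linarith)).integrableOn_isCompact
      (isCompact_closedBall 0 R)).mono_set Metric.ball_subset_closedBall
  unfold kap
  rw [← ofReal_integral_eq_lintegral_ofReal hi (Eventually.of_forall fun z => by positivity)]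
  congr 1
  have := integral_fun_norm_addHaar (volume : Measure (E n))
    ((Set.Iio R).indicator fun r => r ^ ((1 : ℝ) - n))
  rw [← integral_indicator Metric.isOpen_ball.measurableSet]
  have e : (fun z : E n => (Set.Iio R).indicator (fun r : ℝ => r ^ ((1 : ℝ) - n)) ‖z‖) =
      (Metric.ball (0 : E n) R).indicator (fun z => ‖z‖ ^ ((1 : ℝ) - n)) := by
    funext z
    by_cases hz : ‖z‖ < R <;> simp [Set.indicator, hz]
  rw [← e, this, finrank_euclideanSpace_fin]
  have e2 : ∫ y in Set.Ioi (0 : ℝ), y ^ (n - 1) •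
      (Set.Iio R).indicator (fun r : ℝ => r ^ ((1 : ℝ) - n)) y = R := by
    have : ∫ y in Set.Ioi (0 : ℝ), y ^ (n - 1) •
      (Set.Iio R).indicator (fun r : ℝ => r ^ ((1 : ℝ) - n)) y =
        ∫ y in Set.Ioi (0 : ℝ), (Set.Iio R).indicator (fun _ => (1 : ℝ)) y := by
      refine setIntegral_congr_fun measurableSet_Ioi fun y (hy : 0 < y) => ?_
      by_cases hyR : y < R
      · simp only [Set.mem_Iio, hyR, Set.indicator_of_mem, smul_eq_mul]
        rw [← Real.rpow_natCast, ← Real.rpow_add hy, Nat.cast_sub (by omega)]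
        simp
      · simp [hyR]
    rw [this, setIntegral_indicator measurableSet_Iio, Set.Ioi_inter_Iio]
    simp [hR.le]
  rw [e2]
  simp [mul_assoc]

lemma kap_conv (c R : ℝ) (hR : 0 < R)
    (hc : ∫⁻ z in Metric.ball (0 : E n) R, kap z ≤ ENNReal.ofReal (c * R)) (hn : 3 ≤ n)
    (H : E n → ℝ≥0∞) (M : ℝ≥0∞) (hM : ∀ z, H z ≤ M) :
    ∫⁻ z, kap z * H z ≤ ENNReal.ofReal (c * R) * M +
      ENNReal.ofReal ((R ^ (n - 1))⁻¹) * ∫⁻ z, H z := by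
  rw [← lintegral_add_compl _ (Metric.isOpen_ball (x := (0 : E n)) (ε := R)).measurableSet]
  refine add_le_add ?_ ?_
  · calc ∫⁻ z in Metric.ball (0 : E n) R, kap z * H z
        ≤ ∫⁻ z in Metric.ball (0 : E n) R, kap z * M :=
          lintegral_mono fun z => mul_le_mul_right (hM z) _
      _ = (∫⁻ z in Metric.ball (0 : E n) R, kap z) * M := lintegral_mul_const _ kap_meas
      _ ≤ _ := mul_le_mul_left hc _
  · rw [← lintegral_const_mul' _ _ ENNReal.ofReal_ne_top]
    refine (setLIntegral_mono' (Metric.isOpen_ball.measurableSet.compl) fun z hz => ?_).trans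
      (setLIntegral_le_lintegral _ _)
    refine mul_le_mul_left (ENNReal.ofReal_le_ofReal ?_) _
    have hz' : R ≤ ‖z‖ := by simpa using hz
    rw [← Real.rpow_natCast, ← Real.rpow_neg hR.le, Nat.cast_sub (by omega)]
    have : -((n : ℝ) - (1 : ℕ)) = 1 - n := by push_cast; ring
    rw [this]
    refine Real.rpow_le_rpow_of_nonpos hR hz' ?_
    have : (3 : ℝ) ≤ n := by exact_mod_cast hn
    linarith

lemma clm_norm_le (T : E n →L[ℝ] ℝ) : ‖T‖ ≤ ∑ i, |T (EuclideanSpace.single i 1)| := by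
  refine T.opNorm_le_bound (Finset.sum_nonneg fun i _ => abs_nonneg _) fun z => ?_
  have hz : z = ∑ i, z i • EuclideanSpace.single i (1 : ℝ) := by
    ext j
    simp [Finset.sum_apply, Pi.single_apply]
  conv_lhs => rw [hz]
  rw [map_sum, Finset.sum_mul]
  refine (norm_sum_le _ _).trans (Finset.sum_le_sum fun i _ => ?_)
  rw [map_smul, norm_smul, mul_comm, Real.norm_eq_abs]
  exact mul_le_mul_of_nonneg_left (abs_coord_le z i) (abs_nonneg _)

lemma grad_bound (hn : 3 ≤ n) (c : ℝ) {g : E n → E n → ℝ} (hg : Nice g) (x : E n) :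
    ‖fderiv ℝ (fun y => c * Pot (rh g) y) x‖ₑ ≤ ENNReal.ofReal (n * (|c| * ((n : ℝ) - 2))) *
      ∫⁻ z, kap z * ∫⁻ v, ‖g (x - z) v‖ₑ := by
  have hn' : (3 : ℝ) ≤ n := by exact_mod_cast hn
  have hr := hg.rh_C1c
  have hrr := hr.refl x
  set I := ∫ z : E n, ‖z‖ ^ ((1 : ℝ) - n) * |rh g (x - z)| with hI
  have h1 : ‖fderiv ℝ (fun y => c * Pot (rh g) y) x‖ ≤ n * (|c| * ((n : ℝ) - 2)) * I := by
    refine (clm_norm_le _).trans ?_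
    calc _ ≤ ∑ i : Fin n, |c| * (((n : ℝ) - 2) * I) := by
          refine Finset.sum_le_sum fun i _ => ?_
          change |pd i (fun y => c * Pot (rh g) y) x| ≤ _
          rw [pd_const_mul, abs_mul]
          exact mul_le_mul_of_nonneg_left (pd_Pot_bound hn hr i x) (abs_nonneg _)
      _ = _ := by simp; ring
  have hInteg : Integrable (fun z : E n => ‖z‖ ^ ((1 : ℝ) - n) * |rh g (x - z)|) :=
    kint hn _ (by linarith) hrr.1.continuous.abs (hrr.2.comp_left abs_zero)
  rw [← ofReal_norm]
  refine (ENNReal.ofReal_le_ofReal h1).trans ?_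
  have : 0 ≤ (n : ℝ) - 2 := by linarith
  rw [ENNReal.ofReal_mul (by positivity), hI, ofReal_integral_eq_lintegral_ofReal hInteg
    (Eventually.of_forall fun z => by positivity)]
  refine mul_le_mul_right (lintegral_mono fun z => ?_) _
  rw [ENNReal.ofReal_mul (by positivity)]
  refine mul_le_mul_right ?_ _
  rw [← Real.norm_eq_abs, ofReal_norm]
  exact enorm_integral_le_lintegral_enorm _

lemma lhs_bound (D : E n → ℝ) (b : E n → E n → ℝ) :
    ENNReal.ofReal (∫ x : E n, ∫ v : E n, D x * |b x v|) ≤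
      ∫⁻ x, ‖D x‖ₑ * ∫⁻ v, ‖b x v‖ₑ := by
  refine (ENNReal.ofReal_le_ofReal (Real.le_norm_self _)).trans ?_
  rw [ofReal_norm]
  refine (enorm_integral_le_lintegral_enorm _).trans (lintegral_mono fun x => ?_)
  refine (enorm_integral_le_lintegral_enorm _).trans (le_of_eq ?_)
  rw [← lintegral_const_mul' _ _ enorm_ne_top]
  refine lintegral_congr fun v => ?_
  rw [enorm_mul, enorm_abs]

lemma Nice.dens_meas {g : E n → E n → ℝ} (h : Nice g) : Measurable (fun x => ∫⁻ v, ‖g x v‖ₑ) :=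
  Measurable.lintegral_prod_right' (f := fun p : E n × E n => ‖g p.1 p.2‖ₑ)
        h.1.continuous.enorm.measurable

lemma swap_conv (J H : E n → ℝ≥0∞) (hJ : Measurable J) (hH : Measurable H) :
    ∫⁻ x, (∫⁻ z, kap z * J (x - z)) * H x = ∫⁻ y, (∫⁻ z, kap z * H (y + z)) * J y := by
  have k := kap_meas (n := n)
  calc ∫⁻ x, (∫⁻ z, kap z * J (x - z)) * H x
      = ∫⁻ x, ∫⁻ z, kap z * J (x - z) * H x := by
        refine lintegral_congr fun x => ?_
        rw [lintegral_mul_const _ (by fun_prop)]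
    _ = ∫⁻ z, ∫⁻ x, kap z * J (x - z) * H x := lintegral_lintegral_swap (by fun_prop)
    _ = ∫⁻ z, ∫⁻ y, kap z * H (y + z) * J y := by
        refine lintegral_congr fun z => ?_
        rw [← lintegral_add_right_eq_self (fun x => kap z * J (x - z) * H x) z]
        refine lintegral_congr fun y => ?_
        rw [add_sub_cancel_right]; ring
    _ = ∫⁻ y, ∫⁻ z, kap z * H (y + z) * J y := lintegral_lintegral_swap (by fun_prop)
    _ = _ := by
        refine lintegral_congr fun x => ?_
        rw [lintegral_mul_const _ (by fun_prop)]

/-- combined interaction estimate -/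
lemma interaction (hn : 3 ≤ n) (c : ℝ) (hc0 : 0 ≤ c) (t : ℝ) (ht : 0 ≤ t)
    (hc : ∀ R : ℝ, 0 < R → ∫⁻ z in Metric.ball (0 : E n) R, kap z ≤ ENNReal.ofReal (c * R))
    (J : E n → ℝ≥0∞) (B : ℝ) (hB : 0 ≤ B)
    (hM : ∀ z, J z ≤ ENNReal.ofReal (2 ^ n * B / (1 + t) ^ n))
    (hJB : ∫⁻ z, J z ≤ ENNReal.ofReal B) :
    ∫⁻ z, kap z * J z ≤ ENNReal.ofReal ((c * 2 ^ n + 1) * B / (1 + t) ^ (n - 1)) := by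
  have hR : 0 < 1 + t := by linarith
  refine (kap_conv c (1 + t) hR (hc _ hR) hn J _ hM).trans ?_
  refine (add_le_add_right (mul_le_mul_right hJB _) _).trans ?_
  rw [← ENNReal.ofReal_mul (by positivity), ← ENNReal.ofReal_mul (by positivity),
    ← ENNReal.ofReal_add (by positivity) (by positivity)]
  refine ENNReal.ofReal_le_ofReal (le_of_eq ?_)
  obtain ⟨m, rfl⟩ : ∃ m, n = m + 1 := ⟨n - 1, by omega⟩
  simp only [Nat.add_sub_cancel]
  field_simp
  ring

open scoped ENNReal
open Filter Topology

lemma pair_bound (hn : 3 ≤ n) (c : ℝ) (hc0 : 0 ≤ c) (t : ℝ) (ht : 0 ≤ t)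
    (hc : ∀ R : ℝ, 0 < R → ∫⁻ z in Metric.ball (0 : E n) R, kap z ≤ ENNReal.ofReal (c * R))
    (J H : E n → ℝ≥0∞) (hJ : Measurable J) (hH : Measurable H) (B A : ℝ) (hB : 0 ≤ B) (hA : 0 ≤ A)
    (hJB : ∫⁻ z, J z ≤ ENNReal.ofReal B) (hHA : ∫⁻ z, H z ≤ ENNReal.ofReal A)
    (h : (∀ z, J z ≤ ENNReal.ofReal (2 ^ n * B / (1 + t) ^ n)) ∨
      (∀ z, H z ≤ ENNReal.ofReal (2 ^ n * A / (1 + t) ^ n))) :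
    ∫⁻ x, (∫⁻ z, kap z * J (x - z)) * H x ≤
      ENNReal.ofReal ((c * 2 ^ n + 1) * B / (1 + t) ^ (n - 1) * A) := by
  have hR : 0 < 1 + t := by linarith
  rcases h with h | h
  · calc ∫⁻ x, (∫⁻ z, kap z * J (x - z)) * H x
        ≤ ∫⁻ x, ENNReal.ofReal ((c * 2 ^ n + 1) * B / (1 + t) ^ (n - 1)) * H x := by
          refine lintegral_mono fun x => mul_le_mul_left ?_ _
          refine interaction hn c hc0 t ht hc (fun z => J (x - z)) B hB (fun z => h _) ?_
          rw [lintegral_sub_left_eq_self (fun z => J z) x]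
          exact hJB
      _ = ENNReal.ofReal ((c * 2 ^ n + 1) * B / (1 + t) ^ (n - 1)) * ∫⁻ x, H x :=
          lintegral_const_mul _ hH
      _ ≤ _ := by
          rw [ENNReal.ofReal_mul (by positivity)]
          exact mul_le_mul_right hHA _
  · rw [swap_conv J H hJ hH]
    calc ∫⁻ y, (∫⁻ z, kap z * H (y + z)) * J y
        ≤ ∫⁻ y, ENNReal.ofReal ((c * 2 ^ n + 1) * A / (1 + t) ^ (n - 1)) * J y := by
          refine lintegral_mono fun x => mul_le_mul_left ?_ _
          refine interaction hn c hc0 t ht hc (fun z => H (x + z)) A hA (fun z => h _) ?_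
          rw [lintegral_add_left_eq_self (fun z => H z) x]
          exact hHA
      _ = ENNReal.ofReal ((c * 2 ^ n + 1) * A / (1 + t) ^ (n - 1)) * ∫⁻ x, J x :=
          lintegral_const_mul _ hJ
      _ ≤ ENNReal.ofReal ((c * 2 ^ n + 1) * A / (1 + t) ^ (n - 1)) * ENNReal.ofReal B :=
          mul_le_mul_right hJB _
      _ = _ := by
          rw [← ENNReal.ofReal_mul (by positivity)]
          congr 1
          ring

lemma main_bound (hn : 3 ≤ n) (N : ℕ) (hN : 2 * n ≤ N) (cn c : ℝ) (hc0 : 0 ≤ c)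
    (hc : ∀ R : ℝ, 0 < R → ∫⁻ z in Metric.ball (0 : E n) R, kap z ≤ ENNReal.ofReal (c * R))
    (t : ℝ) (ht : 0 ≤ t) {f : E n → E n → ℝ} (hf : Nice f) (A : ℝ)
    (hA : ∀ K : List (VFIdx n), K.length ≤ N → nrm (micL t K f) ≤ A)
    (L K : List (VFIdx n)) (hL : L.length ≤ N) (hK : K.length ≤ N)
    (hLK : L.length + K.length ≤ N + 1) :
    ∫ x : E n, ∫ v : E n, ‖fderiv ℝ (fun y => cn * Pot (rh (gL t L f)) y) x‖ * |micL t K f x v| ≤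
      (n * (|cn| * ((n : ℝ) - 2))) *
        ((c * 2 ^ n + 1) * (((n : ℝ) + 3) ^ N * A) / (1 + t) ^ (n - 1) * A) := by
  have hR : 0 < 1 + t := by linarith
  have hA0 : 0 ≤ A := (nrm_nonneg _).trans (hA [] (by simp))
  have hn2 : (0 : ℝ) ≤ (n : ℝ) - 2 := by
    have : (3 : ℝ) ≤ n := by exact_mod_cast hn
    linarith
  have hg := hf.gL t L
  have hb := hf.micL t K
  have hpow : ((n : ℝ) + 3) ^ L.length * A ≤ ((n : ℝ) + 3) ^ N * A := by
    gcongr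
    have : (0 : ℝ) ≤ n := Nat.cast_nonneg n
    linarith
  have hG : ∀ M : List (VFIdx n), M.length + L.length ≤ N →
      nrm (micL t M (gL t L f)) ≤ ((n : ℝ) + 3) ^ N * A := fun M hM =>
    (gL_bound hf t N A hA L M hM).trans hpow
  rw [← ENNReal.ofReal_le_ofReal_iff (by positivity)]
  refine (lhs_bound (fun x => ‖fderiv ℝ (fun y => cn * Pot (rh (gL t L f)) y) x‖)
    (micL t K f)).trans ?_
  rw [ENNReal.ofReal_mul (by positivity)]
  have key := pair_bound hn c hc0 t ht hc (fun x => ∫⁻ v, ‖gL t L f x v‖ₑ)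
    (fun x => ∫⁻ v, ‖micL t K f x v‖ₑ) hg.dens_meas hb.dens_meas (((n : ℝ) + 3) ^ N * A) A
    (by positivity) hA0
    (by
      refine (le_of_eq hg.Nrm_eq).trans (ENNReal.ofReal_le_ofReal ?_)
      exact hG [] (by simpa using hL))
    ((le_of_eq hb.Nrm_eq).trans (ENNReal.ofReal_le_ofReal (hA K hK)))
    (by
      by_cases h : L.length + n ≤ N
      · left
        exact sob_main t ht _ hg _ (fun M hM => hG M (by omega))
      · right
        refine sob_main t ht _ hb _ (fun M hM => ?_)
        rw [← micL_append]
        exact hA _ (by rw [List.length_append]; omega))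
  refine le_trans ?_ (mul_le_mul_right key _)
  rw [← lintegral_const_mul' _ _ ENNReal.ofReal_ne_top]
  refine lintegral_mono fun x => ?_
  rw [enorm_norm]
  refine (mul_le_mul_left (grad_bound hn cn hg x) _).trans (le_of_eq ?_)
  rw [mul_assoc]

lemma main_thm (N : ℕ) (hn : 3 ≤ n) (hN : 2 * n ≤ N)
    (cn : ℝ) :
    ∃ C : ℝ, 0 < C ∧
      ∀ t : ℝ, 0 ≤ t → ∀ ε : ℝ, 0 < ε →
      ∀ f : E n → E n → ℝ,
        ContDiff ℝ (⊤ : ℕ∞) (fun p : E n × E n => f p.1 p.2) →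
        HasCompactSupport (fun p : E n × E n => f p.1 p.2) →
        (∑ m ∈ Finset.range (N + 1), ∑ α : Fin m → VFIdx n,
            ∫ x : E n, ∫ v : E n,
              |microList (List.ofFn α) (fun _ z w => f z w) t x v|) ≤ 2 * ε →
        ∀ kγ kβ : ℕ, kγ ≤ N → kβ ≤ N → kγ + kβ ≤ N + 1 →
        ∀ (γ : Fin kγ → VFIdx n) (β : Fin kβ → VFIdx n),
          (∫ x : E n, ∫ v : E n,
              ‖fderiv ℝ
                  (macroList (List.ofFn γ)
                    (fun _ z => ∫ y : E n, cn * ‖z - y‖ ^ ((2 : ℝ) - (n : ℝ)) *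
                      ∫ w : E n, f y w) t) x‖ *
                |microList (List.ofFn β) (fun _ z w => f z w) t x v|) ≤
            C * ε / (1 + t) ^ (n - 1) *
              ∑ m ∈ Finset.range (N + 1), ∑ α : Fin m → VFIdx n,
                ∫ x : E n, ∫ v : E n,
                  |microList (List.ofFn α) (fun _ z w => f z w) t x v| := by
  obtain ⟨c, hc0, hc⟩ := kap_ball (n := n) hn
  have hn2 : (0 : ℝ) ≤ (n : ℝ) - 2 := by
    have : (3 : ℝ) ≤ n := by exact_mod_cast hn
    linarith
  refine ⟨2 * (n * (|cn| * ((n : ℝ) - 2))) * ((c * 2 ^ n + 1) * ((n : ℝ) + 3) ^ N) + 1,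
    by positivity, ?_⟩
  intro t ht ε hε f hf1 hf2 hE kγ kβ hkγ hkβ hk γ β
  have hf : Nice f := ⟨hf1, hf2⟩
  have hR : 0 < 1 + t := by linarith
  have hterm : ∀ m : ℕ, ∀ α : Fin m → VFIdx n, (0 : ℝ) ≤
      ∫ x : E n, ∫ v : E n, |microList (List.ofFn α) (fun _ z w => f z w) t x v| := fun m α =>
    integral_nonneg fun _ => integral_nonneg fun _ => abs_nonneg _
  set A : ℝ := ∑ m ∈ Finset.range (N + 1), ∑ α : Fin m → VFIdx n,
            ∫ x : E n, ∫ v : E n,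
              |microList (List.ofFn α) (fun _ z w => f z w) t x v| with hAdef
  have hA : ∀ K : List (VFIdx n), K.length ≤ N → nrm (micL t K f) ≤ A := by
    intro K hK
    have h1 : nrm (micL t K f) = ∫ x : E n, ∫ v : E n,
        |microList (List.ofFn K.get) (fun _ z w => f z w) t x v| := by
      rw [List.ofFn_get, microList_eq]
      rfl
    rw [h1]
    refine le_trans ?_ (Finset.single_le_sum (f := fun m => ∑ α : Fin m → VFIdx n,
            ∫ x : E n, ∫ v : E n,
              |microList (List.ofFn α) (fun _ z w => f z w) t x v|)
      (fun m _ => Finset.sum_nonneg fun α _ => hterm m α)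
      (Finset.mem_range.2 (by omega : K.length < N + 1)))
    exact Finset.single_le_sum (f := fun α : Fin K.length → VFIdx n =>
            ∫ x : E n, ∫ v : E n,
              |microList (List.ofFn α) (fun _ z w => f z w) t x v|)
      (fun α _ => hterm _ α) (Finset.mem_univ K.get)
  have hA0 : 0 ≤ A := (nrm_nonneg _).trans (hA [] (by simp))
  have hm := macroList_Pot hn t cn (List.ofFn γ) hf
    (fun _ z => ∫ y : E n, cn * ‖z - y‖ ^ ((2 : ℝ) - (n : ℝ)) * ∫ w : E n, f y w) (by
      funext x
      simp only [mul_assoc]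
      rw [integral_const_mul, ← Pot_eq]
      rfl)
  rw [hm, microList_eq]
  refine (main_bound hn N hN cn c hc0 hc t ht hf A hA (List.ofFn γ) (List.ofFn β)
    (by simpa using hkγ) (by simpa using hkβ) (by simpa using hk)).trans ?_
  set c1 : ℝ := n * (|cn| * ((n : ℝ) - 2)) with hc1
  set c2 : ℝ := (c * 2 ^ n + 1) * ((n : ℝ) + 3) ^ N with hc2
  have hc1' : 0 ≤ c1 := by positivity
  have hc2' : 0 ≤ c2 := by positivity
  calc c1 * ((c * 2 ^ n + 1) * (((n : ℝ) + 3) ^ N * A) / (1 + t) ^ (n - 1) * A)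
      = c1 * c2 * A / (1 + t) ^ (n - 1) * A := by rw [hc2]; ring
    _ ≤ (2 * c1 * c2 + 1) * ε / (1 + t) ^ (n - 1) * A := by
        gcongr ?_ / _ * _
        nlinarith [mul_nonneg hc1' hc2', mul_le_mul_of_nonneg_left hE (mul_nonneg hc1' hc2')]

end Aux

/-- bilinear estimate `‖∇ₓ(Z^γ φ) Z^β f‖_{L¹} ≲ ε (1+t)^{1-n} 𝓔_N[f]`
for the Vlasov–Poisson potential `φ = G₀ * ρ(f)`. -/
theorem bilinear_estimate_vlasov_poisson (n N : ℕ) (hn : 3 ≤ n) (hN : 2 * n ≤ N)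
    (cn : ℝ) :
    ∃ C : ℝ, 0 < C ∧
      ∀ t : ℝ, 0 ≤ t → ∀ ε : ℝ, 0 < ε →
      ∀ f : E n → E n → ℝ,
        ContDiff ℝ (⊤ : ℕ∞) (fun p : E n × E n => f p.1 p.2) →
        HasCompactSupport (fun p : E n × E n => f p.1 p.2) →
        (∑ m ∈ Finset.range (N + 1), ∑ α : Fin m → VFIdx n,
            ∫ x : E n, ∫ v : E n,
              |microList (List.ofFn α) (fun _ z w => f z w) t x v|) ≤ 2 * ε →
        ∀ kγ kβ : ℕ, kγ ≤ N → kβ ≤ N → kγ + kβ ≤ N + 1 →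
        ∀ (γ : Fin kγ → VFIdx n) (β : Fin kβ → VFIdx n),
          (∫ x : E n, ∫ v : E n,
              ‖fderiv ℝ
                  (macroList (List.ofFn γ)
                    (fun _ z => ∫ y : E n, cn * ‖z - y‖ ^ ((2 : ℝ) - (n : ℝ)) *
                      ∫ w : E n, f y w) t) x‖ *
                |microList (List.ofFn β) (fun _ z w => f z w) t x v|) ≤
            C * ε / (1 + t) ^ (n - 1) *
              ∑ m ∈ Finset.range (N + 1), ∑ α : Fin m → VFIdx n,
                ∫ x : E n, ∫ v : E n,
                  |microList (List.ofFn α) (fun _ z w => f z w) t x v| := by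
  exact main_thm N hn hN cn
end
end
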